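/- (Decorrelation estimate.) Let g : [−1,1]^d × (−∞,∞] → ℝ be a compactly supported nonnegative function of class C². Then for every λ ≥ 0, as L → ∞, E[ ∏_{j=1}^{n_L} ∏_{x₀ ∈ Q_{R_L, z_{j,L}}} exp(−λ g(z_{j,L}/L, a_L(ξ_L(x₀) − a_L))) ] − ∏_{j=1}^{n_L} E[ ∏_{x₀ ∈ Q_{R_L, z_{j,L}}} exp(−λ g(z_{j,L}/L, a_L(ξ_L(x₀) − a_L))) ] → 0; that is, the restrictions of the rescaled field to the well-separated mesoscopic boxes may asymptotically be treated as independent. -/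

import Mathlib

open MeasureTheory ProbabilityTheory Filter Finset

noncomputable section

/-- Euclidean (ℓ²) norm of a point of `ℤ^d`. -/
def znorm {d : ℕ} (x : Fin d → ℤ) : ℝ := Real.sqrt (∑ i, ((x i : ℝ)) ^ 2)

/-- The discrete box `[-a/2, a/2]^d ∩ ℤ^d`. -/
def QBox (d : ℕ) (a : ℝ) : Finset (Fin d → ℤ) :=
  Finset.Icc (fun _ => Int.ceil (-(a / 2))) (fun _ => Int.floor (a / 2))

/-- The translated box `z + ([-a/2, a/2]^d ∩ ℤ^d)`. -/
def QBoxAt {d : ℕ} (a : ℝ) (z : Fin d → ℤ) : Finset (Fin d → ℤ) :=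
  (QBox d a).image (fun x => z + x)

/-- The box `[-1,1]^d ⊂ ℝ^d`. -/
def unitBox (d : ℕ) : Set (Fin d → ℝ) := Set.univ.pi fun _ => Set.Icc (-1) 1

/-- Nearest-neighbour adjacency on `ℤ^d`. -/
def Adj {d : ℕ} (x y : Fin d → ℤ) : Prop := (∑ i, |x i - y i|) = 1

instance {d : ℕ} (x y : Fin d → ℤ) : Decidable (Adj x y) := by
  unfold Adj; infer_instance

/-- `(lam, f)` is an eigenpair of the Anderson Hamiltonian `Δ + V` on `C ⊂ ℤ^d`
with Dirichlet boundary conditions (`f` vanishes outside `C`). -/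
def IsDirichletEigenpair {d : ℕ} (C : Finset (Fin d → ℤ)) (V : (Fin d → ℤ) → ℝ)
    (lam : ℝ) (f : (Fin d → ℤ) → ℝ) : Prop :=
  (∀ x ∉ C, f x = 0) ∧
  ∀ x ∈ C, ((∑ y ∈ C, if Adj x y then f y else 0) - 2 * (d : ℝ) * f x) + V x * f x = lam * f x

/-- `lam` is the largest Dirichlet eigenvalue of `Δ + V` on `C`. -/
def IsTopEigenvalue {d : ℕ} (C : Finset (Fin d → ℤ)) (V : (Fin d → ℤ) → ℝ) (lam : ℝ) : Prop :=
  (∃ f, f ≠ 0 ∧ IsDirichletEigenpair C V lam f) ∧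
  ∀ mu g, g ≠ 0 → IsDirichletEigenpair C V mu g → mu ≤ lam

/-- `(lam, f)` is the principal Dirichlet eigenvalue of `Δ + V` on `C` together with its
ℓ²-normalised nonnegative principal eigenfunction. -/
def IsPrincipalEigenpair {d : ℕ} (C : Finset (Fin d → ℤ)) (V : (Fin d → ℤ) → ℝ)
    (lam : ℝ) (f : (Fin d → ℤ) → ℝ) : Prop :=
  IsDirichletEigenpair C V lam f ∧ (∑ x ∈ C, f x ^ 2) = 1 ∧ (∀ x, 0 ≤ f x) ∧
  ∀ mu g, g ≠ 0 → IsDirichletEigenpair C V mu g → mu ≤ lam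

/-- A complete orthonormal eigenbasis of `Δ + V` on `C` with Dirichlet boundary
conditions, the eigenvalues being listed in nonincreasing order: `lam k` is the
`(k+1)`-th largest eigenvalue (with multiplicity) and `phi k` the associated
normalised eigenfunction. -/
def IsDirichletEigenbasis {d : ℕ} (C : Finset (Fin d → ℤ)) (V : (Fin d → ℤ) → ℝ)
    (lam : ℕ → ℝ) (phi : ℕ → (Fin d → ℤ) → ℝ) : Prop :=
  (∀ k < C.card, IsDirichletEigenpair C V (lam k) (phi k)) ∧
  (∀ j < C.card, ∀ k < C.card, j ≤ k → lam k ≤ lam j) ∧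
  (∀ j < C.card, ∀ k < C.card, (∑ x ∈ C, phi j x * phi k x) = if j = k then 1 else 0)

/-- Covariance of two real random variables. -/
def covar {Ω : Type} [MeasurableSpace Ω] (P : Measure Ω) (X Y : Ω → ℝ) : ℝ :=
  ∫ ω, (X ω - ∫ ω', X ω' ∂P) * (Y ω - ∫ ω', Y ω' ∂P) ∂P

/-- The basic setting of the paper: for each `L`, a centred stationary Gaussian field
`ξ_L` on `ℤ^d` with nonnegative covariance function `v_L`, `v_L(0) = 1`; `d_L` is defined
through `sup_{|x|=1} v_L(x) = 1 − 1/d_L` and `a_L > 0` through `P(ξ_L(0) > a_L) = L^{−d}`. -/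
structure GaussSetting (d : ℕ) (Ω : Type) [MeasurableSpace Ω] where
  P : Measure Ω
  hP : IsProbabilityMeasure P
  ξ : ℕ → Ω → (Fin d → ℤ) → ℝ
  v : ℕ → (Fin d → ℤ) → ℝ
  meas : ∀ L x, Measurable fun ω => ξ L ω x
  v_nonneg : ∀ L x, 0 ≤ v L x
  v_zero : ∀ L, v L 0 = 1
  gaussian : ∀ L, 2 ≤ L → ∀ (s : Finset (Fin d → ℤ)) (c : (Fin d → ℤ) → ℝ),
    Measure.map (fun ω => ∑ x ∈ s, c x * ξ L ω x) P
      = gaussianReal 0 (Real.toNNReal (∑ x ∈ s, ∑ y ∈ s, c x * c y * v L (x - y)))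
  dL : ℕ → ℝ
  dL_pos : ∀ L, 2 ≤ L → 0 < dL L
  dL_def : ∀ L, 2 ≤ L →
    IsGreatest {t : ℝ | ∃ x : Fin d → ℤ, znorm x = 1 ∧ t = v L x} (1 - 1 / dL L)
  aL : ℕ → ℝ
  aL_pos : ∀ L, 2 ≤ L → 0 < aL L
  aL_def : ∀ L, 2 ≤ L →
    P {ω | aL L < ξ L ω 0} = ENNReal.ofReal (1 / (L : ℝ) ^ d)

namespace GaussSetting

variable {d : ℕ} {Ω : Type} [MeasurableSpace Ω] (S : GaussSetting d Ω)

/-- The shape `S_L(x) = a_L (1 − v_L(x))`. -/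
def shape (L : ℕ) (x : Fin d → ℤ) : ℝ := S.aL L * (1 - S.v L x)

/-- Long-range decay assumption (I):
`sup_{|x| ≥ exp(√(ln L))} v_L(x) ln|x| → 0` as `L → ∞`. -/
def LongRangeDecay : Prop :=
  ∀ ε > (0 : ℝ), ∀ᶠ L : ℕ in atTop, ∀ x : Fin d → ℤ,
    Real.exp (Real.sqrt (Real.log L)) ≤ znorm x → S.v L x * Real.log (znorm x) ≤ ε

/-- Short-range decay assumption (II), with constants `c, c' > 0`. -/
def ShortRangeDecay (c c' : ℝ) : Prop :=
  0 < c ∧ 0 < c' ∧ ∀ L, 2 ≤ L → ∀ x : Fin d → ℤ, x ≠ 0 →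
    1 - Real.exp (c' * znorm x) / S.dL L ≤ S.v L x ∧ S.v L x ≤ 1 - c / S.dL L

/-- Assumption 1: `d_L ≪ a_L`. -/
def Assumption1 : Prop := Tendsto (fun L => S.dL L / S.aL L) atTop (nhds 0)

/-- The fluctuation field `ζ_{L,y}(x) = ξ_L(x) − ξ_L(y) v_L(x − y)`. -/
def zeta (L : ℕ) (y x : Fin d → ℤ) (ω : Ω) : ℝ :=
  S.ξ L ω x - S.ξ L ω y * S.v L (x - y)

/-- The field `Φ_L(y) = ∑_{x ∈ Q_{r_L}, x ≠ 0} φ̄_L(x)² ζ_{L,y}(x + y)`. -/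
def Phi (r : ℕ → ℝ) (phiBar : ℕ → (Fin d → ℤ) → ℝ) (L : ℕ) (y : Fin d → ℤ)
    (ω : Ω) : ℝ :=
  ∑ x ∈ (QBox d (r L)).erase 0, phiBar L x ^ 2 * S.zeta L y (x + y) ω

end GaussSetting

/-- The auxiliary mesoscopic data: the scales `r_L, R_L`, the principal eigenpair
`(λ̄_L, φ̄_L)` of `Δ − S_L` on `Q_{r_L}` and `τ_L` with `τ_L² = Var(Φ_L(0))`. -/
structure MesoData {d : ℕ} {Ω : Type} [MeasurableSpace Ω] (S : GaussSetting d Ω) where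
  rL : ℕ → ℝ
  RL : ℕ → ℝ
  lamBar : ℕ → ℝ
  phiBar : ℕ → (Fin d → ℤ) → ℝ
  tau : ℕ → ℝ
  rL_lower : ∀ L, 2 ≤ L → Real.log (S.aL L) ≤ Real.log (rL L)
  rL_upper : Tendsto (fun L => Real.log (rL L) / Real.sqrt (S.aL L)) atTop (nhds 0)
  RL_lower : Tendsto (fun L => S.aL L / Real.log (RL L)) atTop (nhds 0)
  RL_upper : Tendsto (fun L => Real.log (RL L) / (S.aL L * (S.aL L / S.dL L))) atTop (nhds 0)
  principal : ∀ L, 2 ≤ L →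
    IsPrincipalEigenpair (QBox d (rL L)) (fun x => -(S.shape L x)) (lamBar L) (phiBar L)
  tau_nonneg : ∀ L, 0 ≤ tau L
  tau_def : ∀ L, 2 ≤ L → tau L ^ 2 = variance (S.Phi rL phiBar L 0) S.P

/-- Assumption 2: `τ_L ≪ a_L^{-1} (a_L/d_L)^{1/2}`. -/
def Assumption2 {d : ℕ} {Ω : Type} [MeasurableSpace Ω] (S : GaussSetting d Ω)
    (M : MesoData S) : Prop :=
  Tendsto (fun L => S.aL L * M.tau L * Real.sqrt (S.dL L / S.aL L)) atTop (nhds 0)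

/-- The event `E¹_{L,x₀} = {|ξ_L(x₀) − a_L| < θ}`, `θ = 2d+1`. -/
def EventE1 {d : ℕ} {Ω : Type} [MeasurableSpace Ω] (S : GaussSetting d Ω) (L : ℕ)
    (x₀ : Fin d → ℤ) : Set Ω :=
  {ω | |S.ξ L ω x₀ - S.aL L| < 2 * (d : ℝ) + 1}

/-- The event `E²_{L,x₀} = {|ζ_{L,x₀}(x)| ≤ S_L(x−x₀)/10, ∀ x ∈ Q_{2R_L,x₀}}`. -/
def EventE2 {d : ℕ} {Ω : Type} [MeasurableSpace Ω] (S : GaussSetting d Ω) (RL : ℕ → ℝ)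
    (L : ℕ) (x₀ : Fin d → ℤ) : Set Ω :=
  {ω | ∀ x ∈ QBoxAt (2 * RL L) x₀, |S.zeta L x₀ x ω| ≤ S.shape L (x - x₀) / 10}

/-- The event `E³_{L,x₀}` controlling the fluctuation field on `Q_{R_L,x₀}`. -/
def EventE3 {d : ℕ} {Ω : Type} [MeasurableSpace Ω] (S : GaussSetting d Ω) (RL : ℕ → ℝ)
    (κ : ℝ) (L : ℕ) (x₀ : Fin d → ℤ) : Set Ω :=
  {ω | ∀ x ∈ QBoxAt (RL L) x₀, x ≠ x₀ →
    |S.zeta L x₀ x ω| ≤ Real.sqrt (variance (S.zeta L x₀ x) S.P) *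
      (S.aL L / S.dL L) ^ (κ * znorm (x - x₀)) *
      Real.sqrt (max 1 (|S.ξ L ω x₀ - S.aL L| * S.aL L))}

/-- The event `E_{L,x₀} = E¹ ∩ E² ∩ E³`. -/
def EventE {d : ℕ} {Ω : Type} [MeasurableSpace Ω] (S : GaussSetting d Ω) (RL : ℕ → ℝ)
    (κ : ℝ) (L : ℕ) (x₀ : Fin d → ℤ) : Set Ω :=
  EventE1 S L x₀ ∩ EventE2 S RL L x₀ ∩ EventE3 S RL κ L x₀

end


lemma gp_of_lin {Ω T S : Type*} [MeasurableSpace Ω] {P : Measure Ω} {X : T → Ω → ℝ}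
    {Y : S → Ω → ℝ} (hX : IsGaussianProcess X P)
    (h : ∀ s, ∃ (I : Finset T) (c : T → ℝ), ∀ ω, Y s ω = ∑ i ∈ I, c i * X i ω) :
    IsGaussianProcess Y P := by
  apply hX.of_isGaussianProcess
  intro s
  obtain ⟨I, c, hc⟩ := h s
  refine ⟨I, ∑ i : I, (c i) • ContinuousLinearMap.proj (R := ℝ) (φ := fun _ : I => ℝ) i, ?_⟩
  intro ω
  rw [hc ω, ← Finset.sum_coe_sort]
  simp

/-- One dimensional Stein identity. -/
lemma stein_one {f f' : ℝ → ℝ} {C : ℝ} (hf : ∀ y, HasDerivAt f (f' y) y)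
    (hf'm : Measurable f') (hb : ∀ y, |f y| ≤ C) (hb' : ∀ y, |f' y| ≤ C) :
    ∫ y, y * f y ∂(gaussianReal 0 1) = ∫ y, f' y ∂(gaussianReal 0 1) := by
  have h1 : (1 : NNReal) ≠ 0 := one_ne_zero
  have hfc : Continuous f := continuous_iff_continuousAt.2 fun y => (hf y).continuousAt
  rw [integral_gaussianReal_eq_integral_smul h1, integral_gaussianReal_eq_integral_smul h1]
  simp only [smul_eq_mul]
  set p := gaussianPDFReal 0 1 with hp
  have hpd : ∀ y, HasDerivAt p (-(y * p y)) y := by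
    intro y
    have : p = fun y => (√(2 * Real.pi * 1))⁻¹ * Real.exp (-(y) ^ 2 / 2) := by
      ext y; simp [hp, gaussianPDFReal]
    rw [this]
    have h := (((hasDerivAt_pow 2 y).neg.div_const 2).exp).const_mul ((√(2 * Real.pi * 1))⁻¹)
    refine h.congr_deriv ?_
    simp; ring
  have hpi : Integrable p := integrable_gaussianPDFReal 0 1
  have hypi : Integrable (fun y => y * p y) := by
    have h2 : Integrable (fun y : ℝ => y) (gaussianReal 0 1) := by
      have := (memLp_id_gaussianReal (μ := 0) (v := 1) 1).integrable (by simp)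
      exact this
    rw [gaussianReal_of_var_ne_zero _ h1, integrable_withDensity_iff (measurable_gaussianPDF 0 1)
      (by simp [gaussianPDF])] at h2
    simpa [toReal_gaussianPDF] using h2
  have i1 : Integrable (fun y => p y * f' y) := by
    have := hpi.bdd_mul (c := C) hf'm.aestronglyMeasurable (ae_of_all _ (fun y => by simpa using hb' y))
    simpa [mul_comm] using this
  have i2 : Integrable (fun y => p y * (y * f y)) := by
    have := hypi.bdd_mul (c := C) hfc.aestronglyMeasurable (ae_of_all _ (fun y => by simpa using hb y))
    refine this.congr (ae_of_all _ fun y => ?_)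
    simp only; ring
  have i3 : Integrable (fun y => p y * f y) := by
    have := hpi.bdd_mul (c := C) hfc.aestronglyMeasurable (ae_of_all _ (fun y => by simpa using hb y))
    simpa [mul_comm] using this
  have hd : ∀ y, HasDerivAt (fun y => p y * f y) (p y * f' y - p y * (y * f y)) y := by
    intro y
    refine ((hpd y).mul (hf y)).congr_deriv ?_
    ring
  have := integral_eq_zero_of_hasDerivAt_of_integrable hd (i1.sub i2) i3
  rw [integral_sub i1 i2] at this
  linarith

lemma stein_indep {Ω E : Type*} [MeasurableSpace Ω] [MeasurableSpace E] {μ : Measure Ω}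
    [IsProbabilityMeasure μ] {Y : Ω → ℝ} {V : Ω → E} (hY : Measurable Y) (hV : Measurable V)
    (hlaw : μ.map Y = gaussianReal 0 1) (hind : IndepFun Y V μ)
    {H H' : E → ℝ → ℝ} {C : ℝ}
    (hH : Measurable (fun p : E × ℝ => H p.1 p.2)) (hH' : Measurable (fun p : E × ℝ => H' p.1 p.2))
    (hd : ∀ v y, HasDerivAt (H v) (H' v y) y)
    (hb : ∀ v y, |H v y| ≤ C) (hb' : ∀ v y, |H' v y| ≤ C) :
    ∫ ω, Y ω * H (V ω) (Y ω) ∂μ = ∫ ω, H' (V ω) (Y ω) ∂μ := by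
  have hmap : μ.map (fun ω => (V ω, Y ω)) = (μ.map V).prod (gaussianReal 0 1) := by
    rw [← hlaw]
    exact (indepFun_iff_map_prod_eq_prod_map_map hV.aemeasurable hY.aemeasurable).1 hind.symm
  have : IsProbabilityMeasure (μ.map V) := Measure.isProbabilityMeasure_map hV.aemeasurable
  have hm : Measurable (fun ω => (V ω, Y ω)) := hV.prodMk hY
  have e1 : ∫ ω, Y ω * H (V ω) (Y ω) ∂μ
      = ∫ p, p.2 * H p.1 p.2 ∂((μ.map V).prod (gaussianReal 0 1)) := by
    rw [← hmap, integral_map hm.aemeasurable]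
    exact (measurable_snd.mul hH).aestronglyMeasurable
  have e2 : ∫ ω, H' (V ω) (Y ω) ∂μ
      = ∫ p, H' p.1 p.2 ∂((μ.map V).prod (gaussianReal 0 1)) := by
    rw [← hmap, integral_map hm.aemeasurable]
    exact hH'.aestronglyMeasurable
  have hid : Integrable (fun y : ℝ => y) (gaussianReal 0 1) :=
    (memLp_id_gaussianReal (μ := 0) (v := 1) 1).integrable (by simp)
  have i1 : Integrable (fun p : E × ℝ => p.2 * H p.1 p.2) ((μ.map V).prod (gaussianReal 0 1)) := by
    have := (hid.comp_snd (μ.map V)).bdd_mul (c := C) hH.aestronglyMeasurable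
      (ae_of_all _ (fun y => by simpa using hb y.1 y.2))
    refine this.congr (ae_of_all _ fun y => ?_)
    simp only; ring
  have i2 : Integrable (fun p : E × ℝ => H' p.1 p.2) ((μ.map V).prod (gaussianReal 0 1)) :=
    Integrable.of_bound hH'.aestronglyMeasurable C
      (ae_of_all _ (fun y => by simpa using hb' y.1 y.2))
  rw [e1, e2, integral_prod _ i1, integral_prod _ i2]
  congr 1
  ext v
  exact stein_one (hd v) (hH'.comp measurable_prodMk_left) (hb v) (hb' v)


lemma cov_lin {Ω : Type*} [MeasurableSpace Ω] {P : Measure Ω} [IsProbabilityMeasure P]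
    {A B C D : Ω → ℝ} (hA : MemLp A 2 P) (hB : MemLp B 2 P) (hC : MemLp C 2 P) (hD : MemLp D 2 P)
    (a b c d : ℝ) :
    cov[fun ω => a * A ω + b * B ω, fun ω => c * C ω + d * D ω; P]
      = a * c * cov[A, C; P] + a * d * cov[A, D; P] + b * c * cov[B, C; P]
        + b * d * cov[B, D; P] := by
  have h1 : (fun ω => a * A ω + b * B ω) = a • A + b • B := by ext; simp
  have h2 : (fun ω => c * C ω + d * D ω) = c • C + d • D := by ext; simp
  rw [h1, h2, covariance_add_left (hA.const_smul a) (hB.const_smul b)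
    ((hC.const_smul c).add (hD.const_smul d)),
    covariance_add_right (hA.const_smul a) (hC.const_smul c) (hD.const_smul d),
    covariance_add_right (hB.const_smul b) (hC.const_smul c) (hD.const_smul d)]
  simp only [covariance_smul_left, covariance_smul_right]
  ring

/-- Hypotheses on a centred Gaussian process with covariance `ρ`. -/
structure GP {Ω ι : Type*} [MeasurableSpace Ω] (P : Measure Ω) (X : ι → Ω → ℝ)
    (ρ : ι → ι → ℝ) : Prop where
  prob : IsProbabilityMeasure P
  gp : IsGaussianProcess X P
  meas : ∀ i, Measurable (X i)
  mean : ∀ i, ∫ ω, X i ω ∂P = 0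
  cov : ∀ i j, cov[X i, X j; P] = ρ i j
  diag : ∀ i, ρ i i = 1
  nonneg : ∀ i j, 0 ≤ ρ i j

section
variable {Ω ι : Type*} [MeasurableSpace Ω] {P : Measure Ω} {X : ι → Ω → ℝ} {ρ : ι → ι → ℝ}

lemma GP.memLp (h : GP P X ρ) (i : ι) : MemLp (X i) 2 P := (h.gp.hasGaussianLaw_eval i).memLp_two

lemma GP.law (h : GP P X ρ) (i : ι) : P.map (X i) = gaussianReal 0 1 := by
  have := h.prob
  rw [(h.gp.hasGaussianLaw_eval i).map_eq_gaussianReal, h.mean, ← covariance_self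
    (h.meas i).aemeasurable, h.cov, h.diag]
  simp

/-- two independent copies -/
def twoX (X : ι → Ω → ℝ) : ι ⊕ ι → Ω × Ω → ℝ :=
  Sum.elim (fun i ω => X i ω.1) (fun i ω => X i ω.2)

lemma two_gp (h : GP P X ρ) : IsGaussianProcess (twoX X) (P.prod P) := by
  have := h.prob
  constructor
  intro I
  have mres : ∀ J : Finset ι, Measurable (fun ω => J.restrict (X · ω)) := fun J =>
    measurable_pi_lambda _ fun i => h.meas i
  have g1 : HasGaussianLaw (fun ω : Ω × Ω => I.toLeft.restrict (X · ω.1)) (P.prod P) := by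
    constructor
    have e : (P.prod P).map (fun ω : Ω × Ω => I.toLeft.restrict (X · ω.1))
      = ((P.prod P).map Prod.fst).map (fun ω => I.toLeft.restrict (X · ω)) := by
      rw [Measure.map_map (mres _) measurable_fst]; rfl
    rw [e, Measure.map_fst_prod]
    simpa using (h.gp.hasGaussianLaw I.toLeft).isGaussian_map
  have g2 : HasGaussianLaw (fun ω : Ω × Ω => I.toRight.restrict (X · ω.2)) (P.prod P) := by
    constructor
    have e : (P.prod P).map (fun ω : Ω × Ω => I.toRight.restrict (X · ω.2))
      = ((P.prod P).map Prod.snd).map (fun ω => I.toRight.restrict (X · ω)) := by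
      rw [Measure.map_map (mres _) measurable_snd]; rfl
    rw [e, Measure.map_snd_prod]
    simpa using (h.gp.hasGaussianLaw I.toRight).isGaussian_map
  have g3 := IndepFun.hasGaussianLaw g1 g2 (indepFun_prod (mres _) (mres _))
  let L : (I.toLeft → ℝ) × (I.toRight → ℝ) →L[ℝ] (I → ℝ) :=
    ContinuousLinearMap.pi fun i => match i with
      | ⟨.inl x, hx⟩ => (ContinuousLinearMap.proj (R := ℝ) (φ := fun _ : I.toLeft => ℝ)
          ⟨x, mem_toLeft.2 hx⟩).comp (ContinuousLinearMap.fst ℝ _ _)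
      | ⟨.inr x, hx⟩ => (ContinuousLinearMap.proj (R := ℝ) (φ := fun _ : I.toRight => ℝ)
          ⟨x, mem_toRight.2 hx⟩).comp (ContinuousLinearMap.snd ℝ _ _)
  have g4 := g3.map_fun L
  have e : (fun ω => I.restrict (twoX X · ω)) = fun ω : Ω × Ω =>
      L (I.toLeft.restrict (X · ω.1), I.toRight.restrict (X · ω.2)) := by
    funext ω
    ext i
    match i with
    | ⟨.inl x, hx⟩ => simp [L, twoX]
    | ⟨.inr x, hx⟩ => simp [L, twoX]
  rw [e]
  exact g4

lemma two_GP (h : GP P X ρ) : GP (P.prod P) (twoX X)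
    (fun a b => match a, b with
      | .inl i, .inl j => ρ i j
      | .inr i, .inr j => ρ i j
      | .inl _, .inr _ => 0
      | .inr _, .inl _ => 0) := by
  have := h.prob
  have G := two_gp h
  have hm : ∀ i, Measurable (twoX X i) := by
    rintro (i | i)
    · exact (h.meas i).comp measurable_fst
    · exact (h.meas i).comp measurable_snd
  have hml : ∀ i, MemLp (twoX X i) 2 (P.prod P) := fun i => (G.hasGaussianLaw_eval i).memLp_two
  refine ⟨inferInstance, G, hm, ?_, ?_, ?_, ?_⟩
  · rintro (i | i)
    · have := integral_fun_fst (μ := P) (ν := P) (X i)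
      simpa [twoX, h.mean i] using this
    · have := integral_fun_snd (μ := P) (ν := P) (X i)
      simpa [twoX, h.mean i] using this
  · rintro (i | i) (j | j)
    · change cov[_, _; _] = ρ i j
      rw [← h.cov i j]
      have e : (P.prod P).map Prod.fst = P := by rw [Measure.map_fst_prod]; simp
      conv_rhs => rw [← e]
      rw [covariance_map (h.meas i).aestronglyMeasurable (h.meas j).aestronglyMeasurable
        measurable_fst.aemeasurable]
      rfl
    · exact IndepFun.covariance_eq_zero (indepFun_prod (h.meas i) (h.meas j)) (hml (.inl i))
        (hml (.inr j))
    · exact IndepFun.covariance_eq_zero (indepFun_prod (h.meas j) (h.meas i)).symm (hml (.inr i))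
        (hml (.inl j))
    · change cov[_, _; _] = ρ i j
      rw [← h.cov i j]
      have e : (P.prod P).map Prod.snd = P := by rw [Measure.map_snd_prod]; simp
      conv_rhs => rw [← e]
      rw [covariance_map (h.meas i).aestronglyMeasurable (h.meas j).aestronglyMeasurable
        measurable_snd.aemeasurable]
      rfl
  · rintro (i | i) <;> exact h.diag i
  · rintro (i | i) (j | j) <;> first | exact h.nonneg i j | exact le_rfl

/-- rotated field -/
noncomputable def rotX (X : ι → Ω → ℝ) (θ : ℝ) (j : ι) (ω : Ω × Ω) : ℝ :=
  Real.sin θ * X j ω.1 + Real.cos θ * X j ω.2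

/-- derivative of the rotated field -/
noncomputable def rotY (X : ι → Ω → ℝ) (θ : ℝ) (j : ι) (ω : Ω × Ω) : ℝ :=
  Real.cos θ * X j ω.1 + (-Real.sin θ) * X j ω.2

lemma rotX_meas (h : GP P X ρ) (θ : ℝ) (j : ι) : Measurable (rotX X θ j) :=
  (((h.meas j).comp measurable_fst).const_mul _).add (((h.meas j).comp measurable_snd).const_mul _)

lemma rotY_meas (h : GP P X ρ) (θ : ℝ) (j : ι) : Measurable (rotY X θ j) :=
  (((h.meas j).comp measurable_fst).const_mul _).add (((h.meas j).comp measurable_snd).const_mul _)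

lemma rot_cov (h : GP P X ρ) (a b c d : ℝ) (i j : ι) :
    cov[fun ω : Ω × Ω => a * X i ω.1 + b * X i ω.2, fun ω => c * X j ω.1 + d * X j ω.2; P.prod P]
      = (a * c + b * d) * ρ i j := by
  have := h.prob
  have G := two_GP h
  have := cov_lin (G.memLp (.inl i)) (G.memLp (.inr i)) (G.memLp (.inl j)) (G.memLp (.inr j)) a b c d
  rw [G.cov, G.cov, G.cov, G.cov] at this
  simp only [twoX, Sum.elim_inl, Sum.elim_inr] at this
  rw [this]; ring

lemma rot_mean (h : GP P X ρ) (a b : ℝ) (i : ι) :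
    ∫ ω : Ω × Ω, (a * X i ω.1 + b * X i ω.2) ∂(P.prod P) = 0 := by
  have := h.prob
  have G := two_GP h
  have i1 := (G.memLp (.inl i)).integrable (by simp)
  have i2 := (G.memLp (.inr i)).integrable (by simp)
  have m1 := G.mean (.inl i)
  have m2 := G.mean (.inr i)
  simp only [twoX, Sum.elim_inl, Sum.elim_inr] at i1 i2 m1 m2
  rw [integral_add (i1.const_mul a) (i2.const_mul b), integral_const_mul, integral_const_mul, m1, m2]
  simp

/-- Any family of combinations of the two copies is a Gaussian process. -/
lemma rot_gp {κ : Type*} (h : GP P X ρ) {Y : κ → Ω × Ω → ℝ}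
    (hY : ∀ k, ∃ (i j : ι) (a b a' b' : ℝ), ∀ ω, Y k ω =
      a * X i ω.1 + b * X i ω.2 + (a' * X j ω.1 + b' * X j ω.2)) :
    IsGaussianProcess Y (P.prod P) := by
  have g0 : IsGaussianProcess (fun (p : (ι ⊕ ι)) => twoX X p) (P.prod P) := two_gp h
  have g1 : IsGaussianProcess (fun (p : (ι ⊕ ι) × Fin 4) => twoX X p.1) (P.prod P) :=
    g0.comp_right Prod.fst
  refine gp_of_lin g1 fun k => ?_
  classical
  obtain ⟨i, j, a, b, a', b', e⟩ := hY k
  refine ⟨{(.inl i, 0), (.inr i, 1), (.inl j, 2), (.inr j, 3)},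
    fun p => if p.2 = 0 then a else if p.2 = 1 then b else if p.2 = 2 then a' else b', fun ω => ?_⟩
  rw [e ω, Finset.sum_insert (by simp), Finset.sum_insert (by simp), Finset.sum_insert (by simp),
    Finset.sum_singleton]
  simp [twoX]; ring

lemma rotY_law (h : GP P X ρ) (θ : ℝ) (k : ι) :
    (P.prod P).map (rotY X θ k) = gaussianReal 0 1 := by
  have := h.prob
  have g : IsGaussianProcess (fun _ : Unit => rotY X θ k) (P.prod P) :=
    rot_gp h fun _ => ⟨k, k, Real.cos θ, -Real.sin θ, 0, 0, fun ω => by simp [rotY]⟩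
  rw [(g.hasGaussianLaw_eval ()).map_eq_gaussianReal, ← covariance_self
    (rotY_meas h θ k).aemeasurable]
  have e1 := rot_mean h (Real.cos θ) (-Real.sin θ) k
  have e2 := rot_cov h (Real.cos θ) (-Real.sin θ) (Real.cos θ) (-Real.sin θ) k k
  unfold rotY
  rw [e1, e2, h.diag]
  have : Real.cos θ * Real.cos θ + -Real.sin θ * -Real.sin θ = 1 := by
    have := Real.sin_sq_add_cos_sq θ; nlinarith
  rw [this]; simp

lemma rotX_law (h : GP P X ρ) (θ : ℝ) (k : ι) :
    (P.prod P).map (rotX X θ k) = gaussianReal 0 1 := by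
  have := h.prob
  have g : IsGaussianProcess (fun _ : Unit => rotX X θ k) (P.prod P) :=
    rot_gp h fun _ => ⟨k, k, Real.sin θ, Real.cos θ, 0, 0, fun ω => by simp [rotX]⟩
  rw [(g.hasGaussianLaw_eval ()).map_eq_gaussianReal, ← covariance_self
    (rotX_meas h θ k).aemeasurable]
  have e1 := rot_mean h (Real.sin θ) (Real.cos θ) k
  have e2 := rot_cov h (Real.sin θ) (Real.cos θ) (Real.sin θ) (Real.cos θ) k k
  unfold rotX
  rw [e1, e2, h.diag]
  have : Real.sin θ * Real.sin θ + Real.cos θ * Real.cos θ = 1 := by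
    have := Real.sin_sq_add_cos_sq θ; nlinarith
  rw [this]; simp

/-- the residual field -/
noncomputable def resW (X : ι → Ω → ℝ) (ρ : ι → ι → ℝ) (θ : ℝ) (k : ι) (i : ι) (ω : Ω × Ω) : ℝ :=
  X i ω.1 - Real.cos θ * ρ i k * rotY X θ k ω

lemma resW_meas (h : GP P X ρ) (θ : ℝ) (k i : ι) : Measurable (resW X ρ θ k i) :=
  ((h.meas i).comp measurable_fst).sub ((rotY_meas h θ k).const_mul _)

lemma rot_indep (h : GP P X ρ) (θ : ℝ) (k : ι) :
    IndepFun (rotY X θ k) (fun ω (i : ι ⊕ ι) => Sum.elim (resW X ρ θ k) (rotX X θ) i ω)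
      (P.prod P) := by
  have := h.prob
  have G := two_GP h
  have key : IndepFun (fun ω (_ : Unit) => rotY X θ k ω)
      (fun ω (i : ι ⊕ ι) => Sum.elim (resW X ρ θ k) (rotX X θ) i ω) (P.prod P) := by
    apply IsGaussianProcess.indepFun_of_covariance_eq_zero (X := fun _ : Unit => rotY X θ k)
      (Y := Sum.elim (resW X ρ θ k) (rotX X θ))
    · refine rot_gp h ?_
      rintro (_ | i | i)
      · exact ⟨k, k, Real.cos θ, -Real.sin θ, 0, 0, fun ω => by simp [rotY]⟩
      · exact ⟨i, k, 1, 0, -(Real.cos θ * ρ i k * Real.cos θ), (Real.cos θ * ρ i k * Real.sin θ),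
          fun ω => by simp [rotY, resW]; ring⟩
      · exact ⟨i, i, Real.sin θ, Real.cos θ, 0, 0, fun ω => by simp [rotX]⟩
    · exact fun _ => (rotY_meas h θ k).aemeasurable
    · rintro (i | i)
      · exact (resW_meas h θ k i).aemeasurable
      · exact (rotX_meas h θ i).aemeasurable
    · rintro _ (i | i)
      · have mY : MemLp (rotY X θ k) 2 (P.prod P) :=
          ((G.memLp (.inl k)).const_mul _).add ((G.memLp (.inr k)).const_mul _)
        have hs : ∀ i j, ρ i j = ρ j i := fun i j => by rw [← h.cov, ← h.cov, covariance_comm]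
        have e0 := cov_lin mY mY (G.memLp (.inl i)) mY 1 0 1 (-(Real.cos θ * ρ i k))
        have e1 := rot_cov h (Real.cos θ) (-Real.sin θ) 1 0 k i
        have e2 := rot_cov h (Real.cos θ) (-Real.sin θ) (Real.cos θ) (-Real.sin θ) k k
        have f1 : cov[rotY X θ k, twoX X (.inl i); P.prod P] = Real.cos θ * ρ k i := by
          have e5 : (fun ω : Ω × Ω => 1 * X i ω.1 + 0 * X i ω.2) = twoX X (.inl i) := by
            ext ω; simp [twoX]
          rw [e5] at e1
          refine Eq.trans ?_ (e1.trans (by ring))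
          rfl
        have f2 : cov[rotY X θ k, rotY X θ k; P.prod P] = 1 := by
          have hh : Real.cos θ * Real.cos θ + -Real.sin θ * -Real.sin θ = 1 := by
            have := Real.sin_sq_add_cos_sq θ; nlinarith
          rw [hh, h.diag] at e2
          refine Eq.trans ?_ (e2.trans (by ring))
          rfl
        rw [f1, f2] at e0
        have e3 : (fun ω => 1 * twoX X (.inl i) ω + -(Real.cos θ * ρ i k) * rotY X θ k ω)
          = resW X ρ θ k i := by ext ω; simp [twoX, resW]; ring
        have e4 : (fun ω => 1 * rotY X θ k ω + 0 * rotY X θ k ω) = rotY X θ k := by ext; simp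
        rw [e3, e4] at e0
        simp only [Sum.elim_inl]
        rw [e0, hs k i]; ring
      · have e1 := rot_cov h (Real.cos θ) (-Real.sin θ) (Real.sin θ) (Real.cos θ) k i
        simp only [Sum.elim_inr]
        unfold rotY
        change cov[_, fun ω : Ω × Ω => Real.sin θ * X i ω.1 + Real.cos θ * X i ω.2; _] = 0
        rw [e1]; ring
  exact key.comp (φ := fun f : Unit → ℝ => f ()) (ψ := id) (measurable_pi_apply _) measurable_id
end


set_option linter.unusedSectionVars false
section
variable {Ω ι : Type*} [MeasurableSpace Ω] {P : Measure Ω} {X : ι → Ω → ℝ} {ρ : ι → ι → ℝ}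
  [DecidableEq ι]

/-- test functions for the covariance inequality -/
structure TF (φ φ' : ι → ℝ → ℝ) (K : ℝ) : Prop where
  h0 : ∀ i y, 0 ≤ φ i y
  h1 : ∀ i y, φ i y ≤ 1
  hd : ∀ i y, HasDerivAt (φ i) (φ' i y) y
  hm : ∀ i, Measurable (φ' i)
  hK : ∀ i y, |φ' i y| ≤ K
  K0 : 0 ≤ K

variable {φ φ' : ι → ℝ → ℝ} {K : ℝ}

lemma TF.meas (T : TF φ φ' K) (i : ι) : Measurable (φ i) :=
  (continuous_iff_continuousAt.2 fun y => (T.hd i y).continuousAt).measurable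

lemma TF.prod_nonneg (T : TF φ φ' K) (s : Finset ι) (f : ι → ℝ) : 0 ≤ ∏ i ∈ s, φ i (f i) :=
  Finset.prod_nonneg fun i _ => T.h0 i _

lemma TF.prod_le (T : TF φ φ' K) (s : Finset ι) (f : ι → ℝ) : ∏ i ∈ s, φ i (f i) ≤ 1 :=
  Finset.prod_le_one (fun i _ => T.h0 i _) fun i _ => T.h1 i _

lemma TF.prod_abs (T : TF φ φ' K) (s : Finset ι) (f : ι → ℝ) : |∏ i ∈ s, φ i (f i)| ≤ 1 := by
  rw [abs_of_nonneg (T.prod_nonneg s f)]; exact T.prod_le s f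

lemma stein_step (h : GP P X ρ) (T : TF φ φ' K) (s t : Finset ι) (θ : ℝ) (k : ι) :
    ∫ ω, rotY X θ k ω * (φ' k (rotX X θ k ω) * (∏ j ∈ t.erase k, φ j (rotX X θ j ω))
      * ∏ x ∈ s, φ x (X x ω.1)) ∂(P.prod P)
    = ∫ ω, (φ' k (rotX X θ k ω) * (∏ j ∈ t.erase k, φ j (rotX X θ j ω))
      * ∑ x ∈ s, (∏ j ∈ s.erase x, φ j (X j ω.1)) * (φ' x (X x ω.1) * (Real.cos θ * ρ x k)))
        ∂(P.prod P) := by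
  have := h.prob
  let V : Ω × Ω → (ι ⊕ ι → ℝ) := fun ω i => Sum.elim (resW X ρ θ k) (rotX X θ) i ω
  let G : (ι ⊕ ι → ℝ) → ℝ := fun v => φ' k (v (.inr k)) * (∏ j ∈ t.erase k, φ j (v (.inr j)))
  let A : (ι ⊕ ι → ℝ) → ℝ → ι → ℝ := fun v y x => v (.inl x) + (Real.cos θ * ρ x k) * y
  let H : (ι ⊕ ι → ℝ) → ℝ → ℝ := fun v y => G v * ∏ x ∈ s, φ x (A v y x)
  let H' : (ι ⊕ ι → ℝ) → ℝ → ℝ := fun v y => G v *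
    ∑ x ∈ s, (∏ j ∈ s.erase x, φ j (A v y j)) * (φ' x (A v y x) * (Real.cos θ * ρ x k))
  have hV : Measurable V := by
    refine measurable_pi_lambda _ ?_
    rintro (i | i)
    · exact resW_meas h θ k i
    · exact rotX_meas h θ i
  have hGm : Measurable G := ((T.hm k).comp (measurable_pi_apply _)).mul
    (Finset.measurable_fun_prod _ fun j _ => (T.meas j).comp (measurable_pi_apply _))
  have hAm : ∀ x, Measurable (fun p : (ι ⊕ ι → ℝ) × ℝ => A p.1 p.2 x) := fun x =>
    ((measurable_pi_apply _).comp measurable_fst).add (measurable_snd.const_mul _)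
  have hG : ∀ v, |G v| ≤ K := fun v => by
    simp only [G]
    rw [abs_mul]
    calc _ ≤ K * 1 := mul_le_mul (T.hK _ _) (T.prod_abs _ fun j => v (.inr j)) (abs_nonneg _) T.K0
      _ = K := mul_one K
  have hS : ∀ v y, |∑ x ∈ s, (∏ j ∈ s.erase x, φ j (A v y j)) * (φ' x (A v y x) * (Real.cos θ * ρ x k))|
      ≤ ∑ x ∈ s, K * |Real.cos θ * ρ x k| := fun v y => by
    refine (Finset.abs_sum_le_sum_abs _ _).trans (Finset.sum_le_sum fun x _ => ?_)
    rw [abs_mul, abs_mul]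
    calc _ ≤ 1 * (K * |Real.cos θ * ρ x k|) :=
          mul_le_mul (T.prod_abs _ (A v y)) (mul_le_mul_of_nonneg_right (T.hK _ _) (abs_nonneg _))
            (by positivity) zero_le_one
      _ = _ := one_mul _
  have hS0 : 0 ≤ ∑ x ∈ s, K * |Real.cos θ * ρ x k| :=
    Finset.sum_nonneg fun x _ => mul_nonneg T.K0 (abs_nonneg _)
  have st := stein_indep (μ := P.prod P) (Y := rotY X θ k) (V := V) (H := H) (H' := H')
    (C := K + K * ∑ x ∈ s, K * |Real.cos θ * ρ x k|)
    (rotY_meas h θ k) hV (rotY_law h θ k) (rot_indep h θ k)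
    ((hGm.comp measurable_fst).mul
      (Finset.measurable_fun_prod _ fun j _ => (T.meas j).comp (hAm j)))
    ((hGm.comp measurable_fst).mul (Finset.measurable_fun_sum _ fun x _ =>
      (Finset.measurable_fun_prod _ fun j _ => (T.meas j).comp (hAm j)).mul
        (((T.hm x).comp (hAm x)).mul_const _)))
    (fun v y => by
      refine HasDerivAt.const_mul _ ?_
      refine (HasDerivAt.fun_finsetProd (u := s) (f := fun x y => φ x (A v y x))
        (f' := fun x => φ' x (A v y x) * (Real.cos θ * ρ x k)) fun x _ => ?_)
      refine (T.hd x (A v y x)).comp y ?_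
      exact (((hasDerivAt_id y).const_mul (Real.cos θ * ρ x k)).const_add (v (.inl x))).congr_deriv
        (mul_one _))
    (fun v y => by
      simp only [H]
      rw [abs_mul]
      calc _ ≤ K * 1 := mul_le_mul (hG v) (T.prod_abs _ (A v y)) (abs_nonneg _) T.K0
        _ ≤ _ := by rw [mul_one]; exact le_add_of_nonneg_right (mul_nonneg T.K0 hS0))
    (fun v y => by
      simp only [H']
      rw [abs_mul]
      calc _ ≤ K * _ := mul_le_mul (hG v) (hS v y) (abs_nonneg _) T.K0
        _ ≤ _ := le_add_of_nonneg_left T.K0)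
  have hA : ∀ ω x, A (V ω) (rotY X θ k ω) x = X x ω.1 := fun ω x => by
    simp [A, V, resW]
  simpa only [H, H', hA, G, V, Sum.elim_inr] using st

lemma stein_bound (h : GP P X ρ) (T : TF φ φ' K) (s t : Finset ι) (θ : ℝ) (k : ι) (D : ι → ℝ)
    (hD : ∀ x ∈ s, ∫ ω, |φ' x (X x ω.1)| * |φ' k (rotX X θ k ω)| ∂(P.prod P) ≤ D x) :
    |∫ ω, rotY X θ k ω * (φ' k (rotX X θ k ω) * (∏ j ∈ t.erase k, φ j (rotX X θ j ω))
      * ∏ x ∈ s, φ x (X x ω.1)) ∂(P.prod P)| ≤ ∑ x ∈ s, ρ x k * D x := by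
  have := h.prob
  rw [stein_step h T s t θ k]
  have mX : ∀ x, Measurable (fun ω : Ω × Ω => φ' x (X x ω.1)) := fun x =>
    (T.hm x).comp ((h.meas x).comp measurable_fst)
  have mR : Measurable (fun ω : Ω × Ω => φ' k (rotX X θ k ω)) := (T.hm k).comp (rotX_meas h θ k)
  have hIntg : ∀ x, Integrable (fun ω : Ω × Ω => ρ x k * (|φ' x (X x ω.1)| * |φ' k (rotX X θ k ω)|))
      (P.prod P) := fun x => by
    refine Integrable.const_mul (Integrable.of_bound (C := K * K)
      ((mX x).abs.mul mR.abs).aestronglyMeasurable (ae_of_all _ fun ω => ?_)) _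
    simp only [Pi.mul_apply]
    rw [Real.norm_eq_abs, abs_mul, abs_abs, abs_abs]
    exact mul_le_mul (T.hK _ _) (T.hK _ _) (abs_nonneg _) T.K0
  calc _ ≤ ∫ ω, ∑ x ∈ s, ρ x k * (|φ' x (X x ω.1)| * |φ' k (rotX X θ k ω)|) ∂(P.prod P) := by
        rw [← Real.norm_eq_abs]
        refine norm_integral_le_of_norm_le (integrable_finsetSum _ fun x _ => hIntg x)
          (ae_of_all _ fun ω => ?_)
        rw [Real.norm_eq_abs, Finset.mul_sum]
        refine (Finset.abs_sum_le_sum_abs _ _).trans (Finset.sum_le_sum fun x _ => ?_)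
        simp only [abs_mul]
        have a1 := T.prod_abs (t.erase k) (fun j => rotX X θ j ω)
        have a2 := T.prod_abs (s.erase x) (fun j => X j ω.1)
        have a3 := Real.abs_cos_le_one θ
        have a4 := h.nonneg x k
        rw [abs_of_nonneg a4]
        set p := |φ' x (X x ω.1)| with hp
        set q := |φ' k (rotX X θ k ω)| with hq
        set u := |∏ j ∈ t.erase k, φ j (rotX X θ j ω)|
        set v := |∏ j ∈ s.erase x, φ j (X j ω.1)|
        have p0 : 0 ≤ p := abs_nonneg _
        have q0 : 0 ≤ q := abs_nonneg _
        have u0 : 0 ≤ u := abs_nonneg _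
        have v0 : 0 ≤ v := abs_nonneg _
        have w : q * u * (v * (p * (|Real.cos θ| * ρ x k)))
          = (u * v * |Real.cos θ|) * (ρ x k * (p * q)) := by ring
        rw [w]
        have : u * v * |Real.cos θ| ≤ 1 :=
          mul_le_one₀ (mul_le_one₀ a1 v0 a2) (abs_nonneg _) a3
        exact mul_le_of_le_one_left (by positivity) this
    _ = ∑ x ∈ s, ρ x k * ∫ ω, (|φ' x (X x ω.1)| * |φ' k (rotX X θ k ω)|) ∂(P.prod P) := by
        rw [integral_finsetSum _ fun x _ => hIntg x]
        simp_rw [integral_const_mul]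
    _ ≤ _ := Finset.sum_le_sum fun x hx => mul_le_mul_of_nonneg_left (hD x hx) (h.nonneg x k)

lemma rotX_deriv (θ : ℝ) (j : ι) (ω : Ω × Ω) :
    HasDerivAt (fun θ => rotX X θ j ω) (rotY X θ j ω) θ := by
  unfold rotX rotY
  exact ((Real.hasDerivAt_sin θ).mul_const _).add ((Real.hasDerivAt_cos θ).mul_const _)

/-- The Gaussian covariance inequality. -/
theorem cov_ineq (h : GP P X ρ) (T : TF φ φ' K) (s t : Finset ι) (D : ι → ι → ℝ)
    (hD : ∀ θ ∈ Set.Icc (0:ℝ) (Real.pi / 2), ∀ x ∈ s, ∀ y ∈ t,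
      ∫ ω, |φ' x (X x ω.1)| * |φ' y (rotX X θ y ω)| ∂(P.prod P) ≤ D x y) :
    |∫ ω, (∏ x ∈ s, φ x (X x ω)) * (∏ y ∈ t, φ y (X y ω)) ∂P
      - (∫ ω, ∏ x ∈ s, φ x (X x ω) ∂P) * ∫ ω, ∏ y ∈ t, φ y (X y ω) ∂P|
      ≤ 2 * ∑ x ∈ s, ∑ y ∈ t, ρ x y * D x y := by
  have := h.prob
  let A : Ω → ℝ := fun ω => ∏ x ∈ s, φ x (X x ω)
  let F : ℝ → Ω × Ω → ℝ := fun θ ω => A ω.1 * ∏ y ∈ t, φ y (rotX X θ y ω)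
  let F' : ℝ → Ω × Ω → ℝ := fun θ ω => A ω.1 * ∑ y ∈ t, (∏ j ∈ t.erase y, φ j (rotX X θ j ω)) •
    (φ' y (rotX X θ y ω) * rotY X θ y ω)
  have mA : Measurable A := Finset.measurable_fun_prod _ fun x _ => (T.meas x).comp (h.meas x)
  have mF : ∀ θ, Measurable (F θ) := fun θ => (mA.comp measurable_fst).mul
    (Finset.measurable_fun_prod _ fun x _ => (T.meas x).comp (rotX_meas h θ x))
  have mF' : ∀ θ, Measurable (F' θ) := fun θ => (mA.comp measurable_fst).mul
    (Finset.measurable_fun_sum _ fun x _ =>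
      (Finset.measurable_fun_prod _ fun x _ => (T.meas x).comp (rotX_meas h θ x)).mul
      (((T.hm x).comp (rotX_meas h θ x)).mul (rotY_meas h θ x)))
  have iX1 : ∀ j, Integrable (fun ω : Ω × Ω => |X j ω.1|) (P.prod P) := fun j =>
    (((two_GP h).memLp (.inl j)).integrable (by simp)).abs
  have iX2 : ∀ j, Integrable (fun ω : Ω × Ω => |X j ω.2|) (P.prod P) := fun j =>
    (((two_GP h).memLp (.inr j)).integrable (by simp)).abs
  let bd : Ω × Ω → ℝ := fun ω => ∑ y ∈ t, K * (|X y ω.1| + |X y ω.2|)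
  have ibd : Integrable bd (P.prod P) :=
    integrable_finsetSum _ fun y _ => ((iX1 y).add (iX2 y)).const_mul K
  have rotYb : ∀ θ y ω, |rotY X θ y ω| ≤ |X y ω.1| + |X y ω.2| := fun θ y ω => by
    unfold rotY
    refine (abs_add_le _ _).trans ?_
    rw [abs_mul, abs_mul, abs_neg]
    exact add_le_add (mul_le_of_le_one_left (abs_nonneg _) (Real.abs_cos_le_one θ))
      (mul_le_of_le_one_left (abs_nonneg _) (Real.abs_sin_le_one θ))
  have hterm : ∀ θ y ω, |(∏ j ∈ t.erase y, φ j (rotX X θ j ω)) •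
      (φ' y (rotX X θ y ω) * rotY X θ y ω)| ≤ K * (|X y ω.1| + |X y ω.2|) := fun θ y ω => by
    rw [smul_eq_mul, abs_mul, abs_mul]
    calc _ ≤ 1 * (K * (|X y ω.1| + |X y ω.2|)) :=
          mul_le_mul (T.prod_abs _ (fun j => rotX X θ j ω))
            (mul_le_mul (T.hK _ _) (rotYb θ y ω) (abs_nonneg _) T.K0) (by positivity) zero_le_one
      _ = _ := one_mul _
  have hF'b : ∀ θ ω, ‖F' θ ω‖ ≤ bd ω := fun θ ω => by
    simp only [F', bd]
    rw [Real.norm_eq_abs, abs_mul]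
    calc _ ≤ 1 * |∑ y ∈ t, (∏ j ∈ t.erase y, φ j (rotX X θ j ω)) •
          (φ' y (rotX X θ y ω) * rotY X θ y ω)| :=
          mul_le_mul_of_nonneg_right (T.prod_abs s fun j => X j ω.1) (abs_nonneg _)
      _ ≤ _ := by
          rw [one_mul]
          exact (Finset.abs_sum_le_sum_abs _ _).trans (Finset.sum_le_sum fun y _ => hterm θ y ω)
  have hFd : ∀ θ ω, HasDerivAt (F · ω) (F' θ ω) θ := fun θ ω => by
    refine HasDerivAt.const_mul _ ?_
    exact HasDerivAt.fun_finsetProd fun y _ => (T.hd y _).comp θ (rotX_deriv θ y ω)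
  have hFi : ∀ θ, Integrable (F θ) (P.prod P) := fun θ =>
    Integrable.of_bound (C := 1) (mF θ).aestronglyMeasurable (ae_of_all _ fun ω => by
      simp only [F]
      rw [Real.norm_eq_abs, abs_mul]
      exact mul_le_one₀ (T.prod_abs s fun j => X j ω.1) (abs_nonneg _)
        (T.prod_abs t fun j => rotX X θ j ω))
  have hder : ∀ θ, HasDerivAt (fun θ => ∫ ω, F θ ω ∂(P.prod P)) (∫ ω, F' θ ω ∂(P.prod P)) θ :=
    fun θ => (hasDerivAt_integral_of_dominated_loc_of_deriv_le (F := F) (F' := F') (bound := bd)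
      (Filter.univ_mem) (Eventually.of_forall fun θ => (mF θ).aestronglyMeasurable) (hFi θ)
      (mF' θ).aestronglyMeasurable (ae_of_all _ fun ω θ _ => hF'b θ ω) ibd
      (ae_of_all _ fun ω θ _ => hFd θ ω)).2
  have hbound : ∀ θ ∈ Set.Icc (0:ℝ) (Real.pi / 2), ‖∫ ω, F' θ ω ∂(P.prod P)‖
      ≤ ∑ x ∈ s, ∑ y ∈ t, ρ x y * D x y := by
    intro θ hθ
    have e : ∀ ω, F' θ ω = ∑ y ∈ t, rotY X θ y ω * (φ' y (rotX X θ y ω) *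
        (∏ j ∈ t.erase y, φ j (rotX X θ j ω)) * ∏ x ∈ s, φ x (X x ω.1)) := fun ω => by
      simp only [F', A, Finset.mul_sum, smul_eq_mul]
      exact Finset.sum_congr rfl fun y _ => by ring
    simp_rw [e]
    rw [integral_finsetSum]
    · rw [Finset.sum_comm, Real.norm_eq_abs]
      refine (Finset.abs_sum_le_sum_abs _ _).trans (Finset.sum_le_sum fun y hy => ?_)
      exact stein_bound h T s t θ y (fun x => D x y) fun x hx => hD θ hθ x hx y hy
    · intro y _
      refine Integrable.mono' (((iX1 y).add (iX2 y)).const_mul K) ?_ (ae_of_all _ fun ω => ?_)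
      · exact ((rotY_meas h θ y).mul ((((T.hm y).comp (rotX_meas h θ y)).mul
          (Finset.measurable_fun_prod _ fun x _ => (T.meas x).comp (rotX_meas h θ x))).mul
          (mA.comp measurable_fst))).aestronglyMeasurable
      · have e2 : rotY X θ y ω * (φ' y (rotX X θ y ω) *
          (∏ j ∈ t.erase y, φ j (rotX X θ j ω)) * ∏ x ∈ s, φ x (X x ω.1))
          = ((∏ j ∈ t.erase y, φ j (rotX X θ j ω)) •
            (φ' y (rotX X θ y ω) * rotY X θ y ω)) * ∏ x ∈ s, φ x (X x ω.1) := by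
          simp only [smul_eq_mul]; ring
        rw [e2, Real.norm_eq_abs, abs_mul]
        exact (mul_le_of_le_one_right (abs_nonneg _) (T.prod_abs s fun j => X j ω.1)).trans
          (hterm θ y ω)
  have hpi := Real.pi_pos
  have mv := norm_image_sub_le_of_norm_deriv_le_segment' (a := (0:ℝ)) (b := Real.pi / 2)
    (fun θ _ => (hder θ).hasDerivWithinAt)
    (fun θ hθ => hbound θ ⟨hθ.1, hθ.2.le⟩) (Real.pi / 2) ⟨by positivity, le_rfl⟩
  have e0 : ∫ ω, F 0 ω ∂(P.prod P)
      = (∫ ω, ∏ x ∈ s, φ x (X x ω) ∂P) * ∫ ω, ∏ y ∈ t, φ y (X y ω) ∂P := by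
    rw [← integral_prod_mul]
    simp [F, A, rotX]
  have e1 : ∫ ω, F (Real.pi / 2) ω ∂(P.prod P)
      = ∫ ω, (∏ x ∈ s, φ x (X x ω)) * (∏ y ∈ t, φ y (X y ω)) ∂P := by
    have := integral_fun_fst (μ := P) (ν := P)
      (fun ω => (∏ x ∈ s, φ x (X x ω)) * (∏ y ∈ t, φ y (X y ω)))
    simpa [F, A, rotX] using this
  rw [e0, e1, Real.norm_eq_abs] at mv
  refine mv.trans ?_
  have nn : 0 ≤ ∑ x ∈ s, ∑ y ∈ t, ρ x y * D x y :=
    (norm_nonneg _).trans (hbound 0 ⟨le_rfl, by positivity⟩)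
  have := Real.pi_le_four
  nlinarith
end


lemma gauss_chernoff {Ω : Type*} [MeasurableSpace Ω] {μ : Measure Ω} [IsProbabilityMeasure μ]
    {S : Ω → ℝ} {v : NNReal} {w m : ℝ} (hS : μ.map S = gaussianReal 0 v) (hv : (v : ℝ) ≤ w)
    (hw : 0 < w) (hm : 0 ≤ m) : μ.real {ω | m ≤ S ω} ≤ Real.exp (-m ^ 2 / (2 * w)) := by
  have hmgf := mgf_gaussianReal hS (m / w)
  have hIntg : Integrable (fun ω => Real.exp (m / w * S ω)) μ := by
    by_contra hc
    rw [mgf_undef hc] at hmgf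
    exact (Real.exp_pos _).ne hmgf
  refine (measure_ge_le_exp_mul_mgf m (by positivity) hIntg).trans ?_
  rw [hmgf, ← Real.exp_add]
  apply Real.exp_le_exp.2
  have : (v : ℝ) * (m / w) ^ 2 / 2 ≤ w * (m / w) ^ 2 / 2 := by gcongr
  have e : w * (m / w) ^ 2 / 2 = m ^ 2 / (2 * w) := by field_simp
  have e2 : -(m / w) * m = -2 * (m ^ 2 / (2 * w)) := by field_simp
  have e3 : -m ^ 2 / (2 * w) = -(m ^ 2 / (2 * w)) := by ring
  rw [e2, e3]; linarith

/-- Gaussian tail. -/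
noncomputable def Qt (m : ℝ) : ℝ := (gaussianReal 0 1).real (Set.Ici m)

lemma Qt_nonneg (m : ℝ) : 0 ≤ Qt m := measureReal_nonneg

lemma Qt_le_exp {m : ℝ} (hm : 0 ≤ m) : Qt m ≤ Real.exp (-m ^ 2 / 2) := by
  have := gauss_chernoff (μ := gaussianReal 0 1) (S := id) (v := 1) (w := 1) (m := m)
    Measure.map_id (by simp) one_pos hm
  simpa using! this

lemma Qt_anti {m m' : ℝ} (h : m ≤ m') : Qt m' ≤ Qt m :=
  measureReal_mono (Set.Ici_subset_Ici.2 h)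

lemma Qt_eq (m : ℝ) : Qt m = ∫ x in Set.Ioi m, (√(2 * Real.pi))⁻¹ * Real.exp (-x ^ 2 / 2) := by
  have e : (gaussianReal 0 1) (Set.Ici m) = (gaussianReal 0 1) (Set.Ioi m) := by
    have : NullSingletonClass (gaussianReal 0 1) := nullSingletonClass_gaussianReal one_ne_zero
    exact (measure_congr Ioi_ae_eq_Ici).symm
  rw [Qt, Measure.real, e, gaussianReal_apply_eq_integral 0 one_ne_zero,
    ENNReal.toReal_ofReal (setIntegral_nonneg measurableSet_Ioi
      fun x _ => gaussianPDFReal_nonneg _ _ _)]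
  simp [gaussianPDFReal_def]

lemma Qt_int (m : ℝ) : IntegrableOn (fun x : ℝ => (√(2 * Real.pi))⁻¹ * Real.exp (-x ^ 2 / 2))
    (Set.Ioi m) := by
  have := integrable_gaussianPDFReal 0 1
  simp [gaussianPDFReal_def] at this
  have h2 := this.integrableOn (s := Set.Ioi m)
  simpa using h2

lemma sqrt_two_pi_ge : 1 ≤ √(2 * Real.pi) := by
  rw [Real.one_le_sqrt]; have := Real.pi_gt_three; linarith

lemma Qt_le_div {m : ℝ} (hm : 0 < m) : Qt m ≤ Real.exp (-m ^ 2 / 2) / m := by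
  have hder : ∀ x : ℝ, HasDerivAt (fun x => -(Real.exp (-x ^ 2 / 2) / m))
      (x / m * Real.exp (-x ^ 2 / 2)) x := fun x => by
    have h1 : HasDerivAt (fun x : ℝ => -x ^ 2 / 2) (-x) x :=
      (((hasDerivAt_pow 2 x).neg).div_const 2).congr_deriv (by simp; ring)
    exact ((h1.exp.div_const m).neg).congr_deriv (by ring)
  have hlim : Tendsto (fun x : ℝ => -(Real.exp (-x ^ 2 / 2) / m)) atTop (nhds 0) := by
    have h1 : Tendsto (fun x : ℝ => -x ^ 2 / 2) atTop atBot := by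
      apply Tendsto.atBot_div_const two_pos
      exact tendsto_neg_atTop_atBot.comp (tendsto_pow_atTop two_ne_zero)
    simpa using ((Real.tendsto_exp_atBot.comp h1).div_const m).neg
  have hpos : ∀ x ∈ Set.Ioi m, 0 ≤ x / m * Real.exp (-x ^ 2 / 2) := fun x hx => by
    have : 0 < x := hm.trans hx
    positivity
  have hi := integrableOn_Ioi_deriv_of_nonneg' (a := m) (fun x _ => hder x) hpos hlim
  have he := integral_Ioi_of_hasDerivAt_of_nonneg (a := m)
    (hder m).continuousAt.continuousWithinAt (fun x _ => hder x) hpos hlim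
  rw [Qt_eq]
  calc _ ≤ ∫ x in Set.Ioi m, x / m * Real.exp (-x ^ 2 / 2) := by
        refine setIntegral_mono_on (Qt_int m) hi measurableSet_Ioi fun x hx => ?_
        have h1 : (√(2 * Real.pi))⁻¹ ≤ 1 := inv_le_one_of_one_le₀ sqrt_two_pi_ge
        have h2 : 1 ≤ x / m := (one_le_div hm).2 (le_of_lt hx)
        exact mul_le_mul_of_nonneg_right (h1.trans h2) (Real.exp_pos _).le
    _ = _ := by rw [he]; ring

/-- constant of the lower tail bound -/
noncomputable def kap : ℝ := (√(2 * Real.pi))⁻¹ * Real.exp (-(3 / 2))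

lemma kap_pos : 0 < kap := by
  have := sqrt_two_pi_ge
  unfold kap; positivity

lemma Qt_ge {a : ℝ} (ha : 1 ≤ a) : kap * (Real.exp (-a ^ 2 / 2) / a) ≤ Qt a := by
  have ha0 : 0 < a := by linarith
  have hs := sqrt_two_pi_ge
  have hsub : Set.Ioc a (a + 1 / a) ⊆ Set.Ioi a := fun x hx => hx.1
  rw [Qt_eq]
  calc kap * (Real.exp (-a ^ 2 / 2) / a)
      = ∫ x in Set.Ioc a (a + 1 / a), kap * Real.exp (-a ^ 2 / 2) := by
        rw [setIntegral_const]
        simp [Measure.real, ha0.le]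
        ring
    _ ≤ ∫ x in Set.Ioc a (a + 1 / a), (√(2 * Real.pi))⁻¹ * Real.exp (-x ^ 2 / 2) := by
        refine setIntegral_mono_on (integrableOn_const (by simp)) ((Qt_int a).mono_set hsub) measurableSet_Ioc
          fun x hx => ?_
        unfold kap
        rw [mul_assoc, ← Real.exp_add]
        refine mul_le_mul_of_nonneg_left (Real.exp_le_exp.2 ?_) (by positivity)
        have hx0 : 0 ≤ x := by linarith [hx.1]
        have h1 : x ^ 2 ≤ (a + 1 / a) ^ 2 := pow_le_pow_left₀ hx0 hx.2 2
        have h2 : (a + 1 / a) ^ 2 = a ^ 2 + 2 + (1 / a) ^ 2 := by field_simp; ring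
        have h3 : (1 / a) ^ 2 ≤ 1 := pow_le_one₀ (by positivity) ((div_le_one ha0).2 ha)
        linarith
    _ ≤ _ := setIntegral_mono_set (Qt_int a) (ae_of_all _ fun x => by positivity)
        hsub.eventuallyLE

lemma gauss_small_var {v : NNReal} (hv : (v : ℝ) ≤ 1) {m : ℝ} (hm : 0 < m) :
    (gaussianReal 0 v).real (Set.Ici m) ≤ Qt m := by
  have e := gaussianReal_map_const_mul (μ := 0) (v := 1) (√v)
  have e2 : gaussianReal (√(v:ℝ) * 0) (NNReal.mk ((√(v:ℝ)) ^ 2) (sq_nonneg _) * 1)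
      = gaussianReal 0 v := by
    congr 1
    · simp
    · ext; simp
  rw [e2] at e
  rw [← e, map_measureReal_apply (measurable_const_mul _) measurableSet_Ici, Qt]
  refine measureReal_mono fun x hx => ?_
  simp only [Set.mem_preimage, Set.mem_Ici] at hx ⊢
  have h1 : √(v:ℝ) ≤ 1 := by simpa using Real.sqrt_le_sqrt hv
  have h0 : 0 ≤ √(v:ℝ) := Real.sqrt_nonneg _
  have hx0 : 0 ≤ x := by
    by_contra hc
    push Not at hc
    nlinarith
  nlinarith

section
variable {Ω ι : Type*} [MeasurableSpace Ω] {P : Measure Ω} {X : ι → Ω → ℝ} {ρ : ι → ι → ℝ}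

lemma pair_cov (h : GP P X ρ) (θ : ℝ) (i j : ι) :
    cov[twoX X (.inl i), rotX X θ j; P.prod P] = Real.sin θ * ρ i j := by
  have e1 := rot_cov h 1 0 (Real.sin θ) (Real.cos θ) i j
  have e5 : (fun ω : Ω × Ω => 1 * X i ω.1 + 0 * X i ω.2) = twoX X (.inl i) := by
    ext ω; simp [twoX]
  rw [e5] at e1
  refine Eq.trans ?_ (e1.trans (by ring))
  rfl

lemma rotX_memLp (h : GP P X ρ) (θ : ℝ) (j : ι) : MemLp (rotX X θ j) 2 (P.prod P) := by
  have := h.prob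
  have G := two_GP h
  exact ((G.memLp (.inl j)).const_mul _).add ((G.memLp (.inr j)).const_mul _)

lemma rotX_var (h : GP P X ρ) (θ : ℝ) (j : ι) : cov[rotX X θ j, rotX X θ j; P.prod P] = 1 := by
  have e1 := rot_cov h (Real.sin θ) (Real.cos θ) (Real.sin θ) (Real.cos θ) j j
  refine Eq.trans ?_ (e1.trans ?_)
  · rfl
  · rw [h.diag]; have := Real.sin_sq_add_cos_sq θ; nlinarith

/-- law of a linear combination of `X i` and `rotX θ j` -/
lemma pair_law (h : GP P X ρ) (θ : ℝ) (i j : ι) (a b : ℝ) :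
    (P.prod P).map (fun ω => a * X i ω.1 + b * rotX X θ j ω)
      = gaussianReal 0 (a ^ 2 + b ^ 2 + 2 * (a * b) * (Real.sin θ * ρ i j)).toNNReal := by
  have := h.prob
  have G := two_GP h
  have g : IsGaussianProcess (fun _ : Unit => fun ω : Ω × Ω => a * X i ω.1 + b * rotX X θ j ω)
    (P.prod P) := rot_gp h fun _ => ⟨i, j, a, 0, b * Real.sin θ, b * Real.cos θ,
      fun ω => by simp [rotX]; ring⟩
  have mm : Measurable (fun ω : Ω × Ω => a * X i ω.1 + b * rotX X θ j ω) :=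
    (((h.meas i).comp measurable_fst).const_mul _).add ((rotX_meas h θ j).const_mul _)
  rw [(g.hasGaussianLaw_eval ()).map_eq_gaussianReal, ← covariance_self mm.aemeasurable]
  have c := cov_lin (G.memLp (.inl i)) (rotX_memLp h θ j) (G.memLp (.inl i)) (rotX_memLp h θ j)
    a b a b
  have c1 : cov[twoX X (.inl i), twoX X (.inl i); P.prod P] = 1 := by
    rw [G.cov]; exact h.diag i
  rw [covariance_comm (rotX X θ j) (twoX X (.inl i)), pair_cov h, rotX_var h, c1] at c
  have c2 : cov[fun ω : Ω × Ω => a * X i ω.1 + b * rotX X θ j ω,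
      fun ω : Ω × Ω => a * X i ω.1 + b * rotX X θ j ω; P.prod P]
      = a ^ 2 + b ^ 2 + 2 * (a * b) * (Real.sin θ * ρ i j) := by
    refine Eq.trans ?_ (c.trans (by ring))
    rfl
  have m1 := rot_mean h (Real.sin θ) (Real.cos θ) j
  have m0 := rot_mean h 1 0 i
  have me : ∫ ω : Ω × Ω, (a * X i ω.1 + b * rotX X θ j ω) ∂(P.prod P) = 0 := by
    have i1 := (G.memLp (.inl i)).integrable (by simp)
    have i2 := (rotX_memLp h θ j).integrable (by simp)
    have m1 := G.mean (.inl i)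
    have m2 : ∫ ω, rotX X θ j ω ∂(P.prod P) = 0 := rot_mean h (Real.sin θ) (Real.cos θ) j
    simp only [twoX, Sum.elim_inl] at i1 m1
    rw [integral_add (i1.const_mul a) (i2.const_mul b), integral_const_mul, integral_const_mul,
      m1, m2]
    simp
  rw [c2, me]

lemma pair_near (h : GP P X ρ) {θ : ℝ} (hθ : θ ∈ Set.Icc 0 (Real.pi / 2)) (i j : ι) {u : ℝ}
    (hu : 0 ≤ u) : (P.prod P).real {ω | u ≤ X i ω.1 ∧ u ≤ rotX X θ j ω}
      ≤ Real.exp (-u ^ 2 / (1 + ρ i j)) := by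
  have := h.prob
  have hs0 : 0 ≤ Real.sin θ := Real.sin_nonneg_of_nonneg_of_le_pi hθ.1
    (by have := hθ.2; have := Real.pi_pos; linarith)
  have hs1 := Real.sin_le_one θ
  have hr := h.nonneg i j
  have hsr : 0 ≤ Real.sin θ * ρ i j := mul_nonneg hs0 hr
  have hsr' : Real.sin θ * ρ i j ≤ ρ i j := mul_le_of_le_one_left hr hs1
  have c := gauss_chernoff (w := 2 * (1 + ρ i j)) (m := 2 * u) (pair_law h θ i j 1 1)
    (by rw [Real.coe_toNNReal _ (by linarith)]; linarith) (by linarith) (by linarith)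
  calc _ ≤ (P.prod P).real {ω | 2 * u ≤ 1 * X i ω.1 + 1 * rotX X θ j ω} := by
        refine measureReal_mono fun ω hω => ?_
        simp only [Set.mem_ofPred_eq] at hω ⊢
        linarith [hω.1, hω.2]
    _ ≤ _ := c
    _ = _ := by
        congr 1
        have : 1 + ρ i j ≠ 0 := by linarith
        field_simp

lemma pair_far (h : GP P X ρ) {θ : ℝ} (hθ : θ ∈ Set.Icc 0 (Real.pi / 2)) (i j : ι) {u m : ℝ}
    (hu : 0 ≤ u) (hm : 0 < m) (hmu : m ≤ u - 2 * ρ i j * u) :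
    (P.prod P).real {ω | u ≤ X i ω.1 ∧ u ≤ rotX X θ j ω} ≤ Qt u * Qt m + Qt (2 * u) := by
  have := h.prob
  have G := two_GP h
  have hs0 : 0 ≤ Real.sin θ := Real.sin_nonneg_of_nonneg_of_le_pi hθ.1
    (by have := hθ.2; have := Real.pi_pos; linarith)
  have hs1 := Real.sin_le_one θ
  have hr := h.nonneg i j
  have hsr : 0 ≤ Real.sin θ * ρ i j := mul_nonneg hs0 hr
  have hsr' : Real.sin θ * ρ i j ≤ ρ i j := mul_le_of_le_one_left hr hs1
  set r := Real.sin θ * ρ i j with hrdef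
  let Z : Ω × Ω → ℝ := fun ω => -r * X i ω.1 + 1 * rotX X θ j ω
  have lZ : (P.prod P).map Z = _ := pair_law h θ i j (-r) 1
  have mZ : Measurable Z := (((h.meas i).comp measurable_fst).const_mul _).add
    ((rotX_meas h θ j).const_mul _)
  have mX : Measurable (twoX X (.inl i)) := G.meas _
  have ind : IndepFun (twoX X (.inl i)) Z (P.prod P) := by
    have key : IndepFun (fun ω (_ : Unit) => twoX X (.inl i) ω) (fun ω (_ : Unit) => Z ω)
        (P.prod P) := by
      apply IsGaussianProcess.indepFun_of_covariance_eq_zero (X := fun _ : Unit => twoX X (.inl i))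
        (Y := fun _ : Unit => Z)
      · refine rot_gp h ?_
        rintro (_ | _)
        · exact ⟨i, i, 1, 0, 0, 0, fun ω => by simp [twoX]⟩
        · exact ⟨i, j, -r, 0, Real.sin θ, Real.cos θ, fun ω => by simp [Z, rotX]⟩
      · exact fun _ => mX.aemeasurable
      · exact fun _ => mZ.aemeasurable
      · intro _ _
        have c := cov_lin (G.memLp (.inl i)) (G.memLp (.inl i)) (G.memLp (.inl i))
          (rotX_memLp h θ j) 1 0 (-r) 1
        have c1 : cov[twoX X (.inl i), twoX X (.inl i); P.prod P] = 1 := by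
          rw [G.cov]; exact h.diag i
        rw [pair_cov h, c1, ← hrdef] at c
        have e4 : (fun ω => 1 * twoX X (.inl i) ω + 0 * twoX X (.inl i) ω) = twoX X (.inl i) := by
          ext; simp
        rw [e4] at c
        refine Eq.trans ?_ (c.trans (by ring))
        rfl
    exact key.comp (φ := fun f : Unit → ℝ => f ()) (ψ := fun f : Unit → ℝ => f ())
      (measurable_pi_apply _) (measurable_pi_apply _)
  have tail : ∀ q, (P.prod P).real (twoX X (.inl i) ⁻¹' Set.Ici q) = Qt q := fun q => by
    rw [← map_measureReal_apply mX measurableSet_Ici, G.law]; rfl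
  have tailZ : (P.prod P).real (Z ⁻¹' Set.Ici m) ≤ Qt m := by
    rw [← map_measureReal_apply mZ measurableSet_Ici, lZ]
    apply gauss_small_var _ hm
    rw [← hrdef]
    rw [Real.coe_toNNReal']
    apply max_le _ zero_le_one
    nlinarith [sq_nonneg r]
  calc _ ≤ (P.prod P).real ((twoX X (.inl i) ⁻¹' Set.Ici u ∩ Z ⁻¹' Set.Ici m) ∪
          twoX X (.inl i) ⁻¹' Set.Ici (2 * u)) := by
        refine measureReal_mono fun ω hω => ?_
        simp only [Set.mem_ofPred_eq] at hω
        simp only [Set.mem_union, Set.mem_inter_iff, Set.mem_preimage, Set.mem_Ici, twoX,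
          Sum.elim_inl, Z]
        by_cases hc : 2 * u ≤ X i ω.1
        · exact Or.inr hc
        · push Not at hc
          refine Or.inl ⟨hω.1, ?_⟩
          have : r * X i ω.1 ≤ ρ i j * (2 * u) :=
            mul_le_mul hsr' hc.le (hu.trans hω.1) hr
          linarith [hω.2]
    _ ≤ (P.prod P).real (twoX X (.inl i) ⁻¹' Set.Ici u ∩ Z ⁻¹' Set.Ici m) +
          (P.prod P).real (twoX X (.inl i) ⁻¹' Set.Ici (2 * u)) := measureReal_union_le _ _
    _ = Qt u * (P.prod P).real (Z ⁻¹' Set.Ici m) + Qt (2 * u) := by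
        rw [tail, Measure.real, ind.measure_inter_preimage_eq_mul _ _ measurableSet_Ici
          measurableSet_Ici, ENNReal.toReal_mul]
        congr 2
        exact tail u
    _ ≤ _ := by
        have := mul_le_mul_of_nonneg_left tailZ (Qt_nonneg u)
        linarith
end


section
variable {d : ℕ} {Ω : Type} [MeasurableSpace Ω] (S : GaussSetting d Ω)

/-- symmetrised covariance -/
noncomputable def vs (L : ℕ) (w : Fin d → ℤ) : ℝ := (S.v L w + S.v L (-w)) / 2

lemma znorm_neg (w : Fin d → ℤ) : znorm (-w) = znorm w := by simp [znorm]

lemma set_law (L : ℕ) (hL : 2 ≤ L) (x : Fin d → ℤ) :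
    S.P.map (fun ω => S.ξ L ω x) = gaussianReal 0 1 := by
  have h := S.gaussian L hL {x} (fun _ => 1)
  simpa [S.v_zero] using h

lemma set_GP (L : ℕ) (hL : 2 ≤ L) :
    GP S.P (fun x ω => S.ξ L ω x) (fun x y => vs S L (x - y)) := by
  classical
  have := S.hP
  have hgp : IsGaussianProcess (fun x ω => S.ξ L ω x) S.P := by
    constructor
    intro I
    constructor
    have mm : Measurable (fun ω => I.restrict (fun x => S.ξ L ω x)) :=
      measurable_pi_lambda _ fun i => S.meas L i
    apply isGaussian_of_map_eq_gaussianReal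
    intro ℓ
    let c : (Fin d → ℤ) → ℝ := fun x => if hx : x ∈ I then ℓ (Pi.single ⟨x, hx⟩ 1) else 0
    refine ⟨0, (∑ x ∈ I, ∑ y ∈ I, c x * c y * S.v L (x - y)).toNNReal, ?_⟩
    rw [Measure.map_map ℓ.continuous.measurable mm, ← S.gaussian L hL I c]
    congr 1
    ext ω
    have e : I.restrict (fun x => S.ξ L ω x) = ∑ i : I, S.ξ L ω i • (Pi.single i (1:ℝ) : I → ℝ) := by
      ext i
      simp [Finset.sum_apply, Pi.single_apply]
    simp only [Function.comp_apply]
    rw [e, map_sum, ← Finset.sum_coe_sort I]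
    refine Finset.sum_congr rfl fun i _ => ?_
    simp [c, mul_comm]
  have hmem : ∀ x, MemLp (fun ω => S.ξ L ω x) 2 S.P := fun x =>
    (hgp.hasGaussianLaw_eval x).memLp_two
  have hmean : ∀ (X : Ω → ℝ) (v : NNReal), Measurable X → S.P.map X = gaussianReal 0 v →
      ∫ ω, X ω ∂S.P = 0 := fun X v hX h => by
    have e : ∫ y, y ∂(S.P.map X) = ∫ ω, X ω ∂S.P :=
      integral_map hX.aemeasurable measurable_id.aestronglyMeasurable
    rw [← e, h, integral_id_gaussianReal]
  have hvar : ∀ (X : Ω → ℝ) (v : NNReal), Measurable X → S.P.map X = gaussianReal 0 v →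
      Var[X; S.P] = v := fun X v hX h => by
    have e : Var[id; S.P.map X] = Var[X; S.P] := by
      rw [variance_map measurable_id.aemeasurable hX.aemeasurable]; rfl
    rw [← e, h, variance_id_gaussianReal]
  refine ⟨S.hP, hgp, S.meas L, fun x => hmean _ _ (S.meas L x) (set_law S L hL x), ?_, ?_, ?_⟩
  · intro x y
    have vx : ∀ x, Var[fun ω => S.ξ L ω x; S.P] = 1 := fun x => by
      simpa using hvar _ _ (S.meas L x) (set_law S L hL x)
    by_cases hxy : x = y
    · subst hxy
      rw [covariance_self (S.meas L x).aemeasurable, vx]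
      simp [vs, S.v_zero]
    · have g := S.gaussian L hL {x, y} (fun _ => 1)
      have e : (fun ω => ∑ z ∈ ({x, y} : Finset (Fin d → ℤ)), (1:ℝ) * S.ξ L ω z)
        = (fun ω => S.ξ L ω x) + fun ω => S.ξ L ω y := by
        ext ω; simp [Finset.sum_pair hxy]
      rw [e] at g
      have hv := hvar _ _ ((S.meas L x).add (S.meas L y)) g
      rw [variance_add (hmem x) (hmem y), vx, vx, Real.coe_toNNReal _ (by
        refine Finset.sum_nonneg fun a _ => Finset.sum_nonneg fun b _ => ?_
        simpa using S.v_nonneg L _)] at hv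
      simp only [Finset.sum_pair hxy, sub_self, S.v_zero, one_mul] at hv
      have e2 : y - x = -(x - y) := by abel
      rw [e2] at hv
      simp only [vs]
      linarith
  · intro x; simp [vs, S.v_zero]
  · intro x y
    have := S.v_nonneg L (x - y)
    have := S.v_nonneg L (-(x - y))
    simp only [vs]; linarith

lemma vs_nonneg (L : ℕ) (w : Fin d → ℤ) : 0 ≤ vs S L w := by
  have := S.v_nonneg L w
  have := S.v_nonneg L (-w)
  simp only [vs]; linarith

lemma vs_short {c c' : ℝ} (h : S.ShortRangeDecay c c') (L : ℕ) (hL : 2 ≤ L) (w : Fin d → ℤ)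
    (hw : w ≠ 0) : vs S L w ≤ 1 - c / S.dL L := by
  have h1 := (h.2.2 L hL w hw).2
  have h2 := (h.2.2 L hL (-w) (neg_ne_zero.2 hw)).2
  simp only [vs]; linarith

lemma vs_long (h : S.LongRangeDecay) {ε : ℝ} (hε : 0 < ε) : ∀ᶠ L : ℕ in atTop,
    ∀ w : Fin d → ℤ, Real.exp (Real.sqrt (Real.log L)) ≤ znorm w →
      vs S L w * Real.log (znorm w) ≤ ε := by
  filter_upwards [h ε hε] with L hL w hw
  have h1 := hL w hw
  have h2 := hL (-w) (by rwa [znorm_neg])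
  rw [znorm_neg] at h2
  simp only [vs]
  linarith

lemma Qt_aL (L : ℕ) (hL : 2 ≤ L) : Qt (S.aL L) = 1 / (L : ℝ) ^ d := by
  have : NullSingletonClass (gaussianReal 0 1) := nullSingletonClass_gaussianReal one_ne_zero
  have e : (gaussianReal 0 1) (Set.Ici (S.aL L)) = (gaussianReal 0 1) (Set.Ioi (S.aL L)) :=
    (measure_congr Ioi_ae_eq_Ici).symm
  rw [Qt, Measure.real, e, ← set_law S L hL 0, Measure.map_apply (S.meas L 0) measurableSet_Ioi]
  have := S.aL_def L hL
  change (S.P {ω | S.aL L < S.ξ L ω 0}).toReal = _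
  rw [this, ENNReal.toReal_ofReal (by positivity)]

lemma aL_tendsto (hd : 1 ≤ d) : Tendsto S.aL atTop atTop := by
  rw [tendsto_atTop]
  intro A
  have h1 : 0 < Qt (max A 1) := lt_of_lt_of_le
    (mul_pos kap_pos (div_pos (Real.exp_pos _) (by positivity))) (Qt_ge (le_max_right A 1))
  have ht : Tendsto (fun L : ℕ => 1 / (L : ℝ) ^ d) atTop (nhds 0) := by
    simp_rw [one_div]
    exact ((tendsto_pow_atTop (by omega)).comp tendsto_natCast_atTop_atTop).inv_tendsto_atTop
  filter_upwards [ht.eventually_lt_const h1, eventually_ge_atTop 2] with L h2 hL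
  by_contra hc
  push Not at hc
  rw [← Qt_aL S L hL] at h2
  exact absurd (Qt_anti (hc.le.trans (le_max_left A 1))) (not_le.2 h2)

lemma N_le (L : ℕ) (hL : 2 ≤ L) (ha : 1 ≤ S.aL L) :
    (L : ℝ) ^ d ≤ S.aL L / kap * Real.exp (S.aL L ^ 2 / 2) := by
  have h := Qt_ge ha
  rw [Qt_aL S L hL] at h
  have hN : 0 < (L : ℝ) ^ d := by
    have : 0 < L := by omega
    positivity
  have hk := kap_pos
  have ha0 : 0 < S.aL L := by linarith
  have e : kap * (Real.exp (-S.aL L ^ 2 / 2) / S.aL L)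
    = (S.aL L / kap * Real.exp (S.aL L ^ 2 / 2))⁻¹ := by
    rw [neg_div, Real.exp_neg]; field_simp
  rw [e, one_div] at h
  exact (inv_le_inv₀ (by positivity) hN).1 h

lemma sqrt_log_le (hd : 1 ≤ d) : ∀ᶠ L : ℕ in atTop,
    Real.sqrt (Real.log L) ≤ 2 * S.aL L := by
  filter_upwards [(aL_tendsto S hd).eventually_ge_atTop 1, eventually_ge_atTop 2,
    (aL_tendsto S hd).eventually_ge_atTop (1 / kap)] with L ha hL hk
  have hN := N_le S L hL ha
  have kp := kap_pos
  rw [Real.sqrt_le_left (by linarith)]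
  have hLp : (0:ℝ) < L := by have : 0 < L := by omega
                             positivity
  have hLN : (L : ℝ) ≤ (L : ℝ) ^ d :=
    le_self_pow₀ (by exact_mod_cast (by omega : 1 ≤ L)) (by omega)
  have h1 : S.aL L / kap ≤ Real.exp (S.aL L ^ 2) := by
    have : S.aL L / kap ≤ S.aL L ^ 2 := by
      have : S.aL L / kap = S.aL L * (1 / kap) := by ring
      rw [this, sq]
      exact mul_le_mul_of_nonneg_left hk (by linarith)
    linarith [Real.add_one_le_exp (S.aL L ^ 2)]
  have h2 : (L : ℝ) ≤ Real.exp (S.aL L ^ 2 + S.aL L ^ 2 / 2) := by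
    rw [Real.exp_add]
    exact (hLN.trans hN).trans (mul_le_mul_of_nonneg_right h1 (Real.exp_pos _).le)
  rw [Real.log_le_iff_le_exp hLp]
  refine h2.trans (Real.exp_le_exp.2 ?_)
  nlinarith [sq_nonneg (S.aL L)]
end


/-- smooth truncation -/
noncomputable def TM (M s : ℝ) : ℝ :=
  s * (1 - Real.smoothTransition (s - M)) + (M + 1) * Real.smoothTransition (s - M)

lemma TM_le {M s : ℝ} (h : s ≤ M) : TM M s = s := by
  simp [TM, Real.smoothTransition.zero_of_nonpos (sub_nonpos.2 h)]

lemma TM_ge {M s : ℝ} (h : M + 1 ≤ s) : TM M s = M + 1 := by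
  simp [TM, Real.smoothTransition.one_of_one_le (by linarith : 1 ≤ s - M)]

lemma TM_contDiff (M : ℝ) : ContDiff ℝ 1 (TM M) := by
  have h : ContDiff ℝ 1 (fun s => Real.smoothTransition (s - M)) :=
    Real.smoothTransition.contDiff.comp (contDiff_id.sub contDiff_const)
  exact (contDiff_id.mul (contDiff_const.sub h)).add (contDiff_const.mul h)

lemma test_fn {d : ℕ} (g : (Fin d → ℝ) × EReal → ℝ) (hg0 : ∀ p, 0 ≤ g p) {c₀ : ℝ} (hc : 0 < c₀)
    (hgc : ∀ p : (Fin d → ℝ) × EReal, p.2 ≤ ((-c₀ : ℝ) : EReal) → g p = 0)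
    (hgd : ContDiff ℝ 2 (fun p : (Fin d → ℝ) × ℝ => g (p.1, (p.2 : EReal))))
    (lam : ℝ) (hl : 0 ≤ lam) {M : ℝ} (hM : 0 ≤ M) :
    ∃ (ψ ψ' : (Fin d → ℝ) → ℝ → ℝ) (K : ℝ), 0 ≤ K ∧ (∀ q s, 0 ≤ ψ q s) ∧ (∀ q s, ψ q s ≤ 1) ∧
      (∀ q s, HasDerivAt (ψ q) (ψ' q s) s) ∧ (∀ q, Measurable (ψ' q)) ∧
      (∀ q ∈ unitBox d, ∀ s, |ψ' q s| ≤ K) ∧ (∀ q s, s < -c₀ → ψ' q s = 0) ∧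
      (∀ q s, s ≤ M → ψ q s = Real.exp (-(lam * g (q, (s : EReal))))) := by
  let F : (Fin d → ℝ) × ℝ → ℝ := fun p => Real.exp (-(lam * g (p.1, ((TM M p.2 : ℝ) : EReal))))
  have hF : ContDiff ℝ 1 F := by
    have h1 : ContDiff ℝ 1 (fun p : (Fin d → ℝ) × ℝ => (p.1, TM M p.2)) :=
      contDiff_fst.prodMk ((TM_contDiff M).comp contDiff_snd)
    have h2 := (hgd.of_le (by norm_num : (1 : WithTop ℕ∞) ≤ 2)).comp h1
    exact (contDiff_const.mul h2).neg.exp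
  let F' : (Fin d → ℝ) × ℝ → ℝ := fun p => fderiv ℝ F p (0, 1)
  have hF' : Continuous F' := (hF.continuous_fderiv one_ne_zero).clm_apply continuous_const
  have hder : ∀ q s, HasDerivAt (fun s => F (q, s)) (F' (q, s)) s := fun q s => by
    have h1 := (hF.differentiable one_ne_zero (q, s)).hasFDerivAt
    have h2 : HasDerivAt (fun s : ℝ => ((q, s) : (Fin d → ℝ) × ℝ)) (0, 1) s :=
      (hasDerivAt_const s q).prodMk (hasDerivAt_id s)
    exact h1.comp_hasDerivAt s h2
  have hlow : ∀ q s, s < -c₀ → F' (q, s) = 0 := fun q s hs => by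
    refine (hder q s).unique ?_
    refine (hasDerivAt_const s (1:ℝ)).congr_of_eventuallyEq ?_
    filter_upwards [Iio_mem_nhds hs] with t ht
    have ht : t < -c₀ := ht
    simp only [F]
    rw [TM_le (by linarith), hgc]
    · simp
    · exact EReal.coe_le_coe_iff.2 ht.le
  have hhigh : ∀ q s, M + 1 < s → F' (q, s) = 0 := fun q s hs => by
    refine (hder q s).unique ?_
    refine (hasDerivAt_const s (F (q, M + 1))).congr_of_eventuallyEq ?_
    filter_upwards [Ioi_mem_nhds hs] with t ht
    have ht : M + 1 < t := ht
    simp only [F]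
    rw [TM_ge ht.le, TM_ge le_rfl]
  have hcomp : IsCompact (unitBox d ×ˢ Set.Icc (-c₀) (M + 1)) :=
    (isCompact_univ_pi fun _ => isCompact_Icc).prod isCompact_Icc
  obtain ⟨K, hK⟩ := hcomp.exists_bound_of_continuousOn hF'.continuousOn
  refine ⟨fun q s => F (q, s), fun q s => F' (q, s), max K 0, le_max_right _ _,
    fun q s => (Real.exp_pos _).le, fun q s => ?_, hder, fun q => ?_, fun q hq s => ?_, hlow,
    fun q s hs => ?_⟩
  · exact Real.exp_le_one_iff.2 (neg_nonpos.2 (mul_nonneg hl (hg0 _)))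
  · exact (hF'.comp (by fun_prop : Continuous fun s : ℝ => (q, s))).measurable
  · by_cases h1 : s < -c₀
    · simp [hlow q s h1]
    by_cases h2 : M + 1 < s
    · simp [hhigh q s h2]
    push Not at h1 h2
    exact (hK (q, s) ⟨hq, h1, h2⟩).trans (le_max_left _ _)
  · simp only [F]; rw [TM_le hs]


lemma abs_le_znorm {d : ℕ} (x : Fin d → ℤ) (i : Fin d) : |(x i : ℝ)| ≤ znorm x := by
  unfold znorm
  rw [← Real.sqrt_sq_eq_abs]
  exact Real.sqrt_le_sqrt (Finset.single_le_sum (f := fun i => ((x i : ℝ)) ^ 2)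
    (fun i _ => sq_nonneg _) (Finset.mem_univ i))

lemma card_ball {d : ℕ} (Q : Finset (Fin d → ℤ)) (x : Fin d → ℤ) {B : ℝ} (hB : 1 ≤ B) :
    ((Q.filter (fun y => znorm (x - y) < B)).card : ℝ) ≤ (3 * B) ^ d := by
  have hsub : Q.filter (fun y => znorm (x - y) < B) ⊆
      Finset.Icc (fun i => x i - ⌊B⌋) (fun i => x i + ⌊B⌋) := by
    intro y hy
    rw [Finset.mem_filter] at hy
    have h : ∀ i, |x i - y i| ≤ ⌊B⌋ := fun i => by
      rw [Int.le_floor]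
      have := abs_le_znorm (x - y) i
      push_cast [Pi.sub_apply] at this ⊢
      linarith [hy.2]
    rw [Finset.mem_Icc, Pi.le_def, Pi.le_def]
    exact ⟨fun i => by have := abs_le.1 (h i); omega,
      fun i => by have := abs_le.1 (h i); omega⟩
  have hc := Finset.card_le_card hsub
  rw [Pi.card_Icc] at hc
  have hf : 1 ≤ ⌊B⌋ := Int.le_floor.2 (by exact_mod_cast hB)
  have e : ∀ i : Fin d, ((Finset.Icc (x i - ⌊B⌋) (x i + ⌊B⌋)).card : ℝ) ≤ 3 * B := fun i => by
    rw [Int.card_Icc]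
    have h1 : ((x i + ⌊B⌋ + 1 - (x i - ⌊B⌋)).toNat : ℤ) = 2 * ⌊B⌋ + 1 := by omega
    have h2 : ((x i + ⌊B⌋ + 1 - (x i - ⌊B⌋)).toNat : ℝ) = 2 * ⌊B⌋ + 1 := by exact_mod_cast h1
    rw [h2]
    have := Int.floor_le B
    linarith
  calc ((Q.filter (fun y => znorm (x - y) < B)).card : ℝ)
      ≤ ((∏ i, (Finset.Icc (x i - ⌊B⌋) (x i + ⌊B⌋)).card : ℕ) : ℝ) := by exact_mod_cast hc
    _ ≤ ∏ i : Fin d, (3 * B) := by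
        push_cast
        exact Finset.prod_le_prod (fun i _ => by positivity) fun i _ => e i
    _ = _ := by simp

lemma card_QBox (d : ℕ) (L : ℕ) (hL : 1 ≤ L) :
    ((QBox d (L : ℝ)).card : ℝ) ≤ 2 ^ d * (L : ℝ) ^ d := by
  unfold QBox
  rw [Pi.card_Icc]
  have hLr : (1:ℝ) ≤ L := by exact_mod_cast hL
  have e : ((Finset.Icc ⌈-((L:ℝ) / 2)⌉ ⌊(L:ℝ) / 2⌋).card : ℝ) ≤ 2 * L := by
    rw [Int.card_Icc]
    have h1 := Int.floor_le ((L:ℝ) / 2)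
    have h2 := Int.le_ceil (-((L:ℝ) / 2))
    have h3 : ((⌊(L:ℝ) / 2⌋ + 1 - ⌈-((L:ℝ) / 2)⌉ : ℤ) : ℝ) ≤ 2 * L := by push_cast; linarith
    have h4 : ((⌊(L:ℝ) / 2⌋ + 1 - ⌈-((L:ℝ) / 2)⌉).toNat : ℤ) ≤ max (⌊(L:ℝ) / 2⌋ + 1 - ⌈-((L:ℝ) / 2)⌉) 0 := by
      omega
    have h5 : ((⌊(L:ℝ) / 2⌋ + 1 - ⌈-((L:ℝ) / 2)⌉).toNat : ℝ) ≤
        max (((⌊(L:ℝ) / 2⌋ + 1 - ⌈-((L:ℝ) / 2)⌉ : ℤ)) : ℝ) 0 := by exact_mod_cast h4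
    exact h5.trans (max_le h3 (by linarith))
  calc _ ≤ ∏ i : Fin d, (2 * (L:ℝ)) := by
        push_cast
        exact Finset.prod_le_prod (fun i _ => by positivity) fun i _ => e
    _ = _ := by simp [mul_pow]

section
variable {a c0 : ℝ}

lemma usq_ge (ha : 1 ≤ a) : a ^ 2 - 2 * c0 ≤ (a - c0 / a) ^ 2 := by
  have : (a - c0 / a) ^ 2 = a ^ 2 - 2 * c0 + (c0 / a) ^ 2 := by field_simp; ring
  rw [this]; nlinarith [sq_nonneg (c0 / a)]

lemma near_exp {V δ A : ℝ} (ha : 1 ≤ a) (hc : 0 ≤ c0) (hac : 2 * c0 ≤ a ^ 2) (hV : 0 ≤ V)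
    (hVδ : V ≤ 1 - δ) (hδ : 0 ≤ δ) (hA : A * a ≤ a ^ 2 * δ / 4) :
    Real.exp (-(a - c0 / a) ^ 2 / (1 + V)) ≤ Real.exp (2 * c0) * Real.exp (-a ^ 2 / 2 - A * a) := by
  rw [← Real.exp_add]
  apply Real.exp_le_exp.2
  have h1 := usq_ge (c0 := c0) ha
  have h2 : (1 / 2 + δ / 4) * (1 + V) ≤ 1 := by nlinarith
  have h3 : (a ^ 2 - 2 * c0) * (1 / 2 + δ / 4) ≤ (a - c0 / a) ^ 2 / (1 + V) := by
    rw [le_div_iff₀ (by linarith), mul_assoc]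
    nlinarith
  have h4 : -(a - c0 / a) ^ 2 / (1 + V) = -((a - c0 / a) ^ 2 / (1 + V)) := by ring
  rw [h4]
  nlinarith

lemma mid_exp {V : ℝ} (ha : 1 ≤ a) (hc : 0 ≤ c0) (hac : 2 * c0 ≤ a ^ 2) (hV : 0 ≤ V)
    (hV2 : V ≤ 1 / 2) :
    Real.exp (-(a - c0 / a) ^ 2 / (1 + V)) ≤ Real.exp (2 * c0) * Real.exp (-(2 / 3) * a ^ 2) := by
  rw [← Real.exp_add]
  apply Real.exp_le_exp.2
  have h1 := usq_ge (c0 := c0) ha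
  have h3 : (a ^ 2 - 2 * c0) * (2 / 3) ≤ (a - c0 / a) ^ 2 / (1 + V) := by
    rw [le_div_iff₀ (by linarith), mul_assoc]
    nlinarith
  have h4 : -(a - c0 / a) ^ 2 / (1 + V) = -((a - c0 / a) ^ 2 / (1 + V)) := by ring
  rw [h4]
  nlinarith

lemma Qt_shift {b : ℝ} (ha : 1 ≤ a) (hb : 0 ≤ b) (hab : 2 * b ≤ a ^ 2) :
    a / 2 ≤ a - b / a ∧ Qt (a - b / a) ≤ 2 * Real.exp b * (Real.exp (-a ^ 2 / 2) / a) := by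
  have ha0 : 0 < a := by linarith
  have h1 : a / 2 ≤ a - b / a := by
    have : b / a ≤ a / 2 := by rw [div_le_iff₀ ha0]; nlinarith
    linarith
  refine ⟨h1, (Qt_le_div (by linarith)).trans ?_⟩
  have h2 := usq_ge (c0 := b) ha
  have h3 : Real.exp (-(a - b / a) ^ 2 / 2) ≤ Real.exp b * Real.exp (-a ^ 2 / 2) := by
    rw [← Real.exp_add]
    apply Real.exp_le_exp.2
    linarith
  calc _ ≤ (Real.exp b * Real.exp (-a ^ 2 / 2)) / (a / 2) := by gcongr
    _ = _ := by field_simp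

/-- constant of the far regime -/
noncomputable def C3 (c0 : ℝ) : ℝ := 4 * Real.exp (2 * c0 + 2) + Real.exp (4 * c0)

lemma C3_pos (c0 : ℝ) : 0 < C3 c0 := by unfold C3; positivity

lemma far_exp (ha : 1 ≤ a) (hc : 0 ≤ c0) (hac : 2 * (c0 + 2) ≤ a ^ 2) :
    Qt (a - c0 / a) * Qt (a - (c0 + 2) / a) + Qt (2 * (a - c0 / a))
      ≤ C3 c0 * (Real.exp (-a ^ 2) / a ^ 2) := by
  have ha0 : 0 < a := by linarith
  obtain ⟨h1, h2⟩ := Qt_shift (b := c0) ha hc (by linarith)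
  obtain ⟨h3, h4⟩ := Qt_shift (b := c0 + 2) ha (by linarith) hac
  have h5 : Qt (2 * (a - c0 / a)) ≤ Real.exp (4 * c0) * (Real.exp (-a ^ 2) / a ^ 2) := by
    refine (Qt_le_exp (by linarith)).trans ?_
    have h6 := usq_ge (c0 := c0) ha
    have h7 : Real.exp (-(2 * (a - c0 / a)) ^ 2 / 2)
        ≤ Real.exp (4 * c0) * (Real.exp (-a ^ 2) * Real.exp (-a ^ 2)) := by
      rw [← Real.exp_add, ← Real.exp_add]
      apply Real.exp_le_exp.2
      nlinarith
    refine h7.trans ?_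
    rw [div_eq_mul_inv]
    have : Real.exp (-a ^ 2) ≤ (a ^ 2)⁻¹ := by
      rw [Real.exp_neg]
      apply inv_anti₀ (by positivity)
      linarith [Real.add_one_le_exp (a ^ 2)]
    gcongr
  have h8 := mul_le_mul h2 h4 (Qt_nonneg _) (by positivity)
  have e : 2 * Real.exp c0 * (Real.exp (-a ^ 2 / 2) / a) *
      (2 * Real.exp (c0 + 2) * (Real.exp (-a ^ 2 / 2) / a))
      = 4 * Real.exp (2 * c0 + 2) * (Real.exp (-a ^ 2) / a ^ 2) := by
    have e1 : Real.exp (2 * c0 + 2) = Real.exp c0 * Real.exp (c0 + 2) := by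
      rw [← Real.exp_add]; ring_nf
    have e2 : Real.exp (-a ^ 2) = Real.exp (-a ^ 2 / 2) * Real.exp (-a ^ 2 / 2) := by
      rw [← Real.exp_add]; ring_nf
    rw [e1, e2]; field_simp; ring
  rw [e] at h8
  unfold C3
  rw [add_mul]
  linarith
end

/-- bound on the joint exceedance probability -/
noncomputable def qq (d : ℕ) (a c0 z : ℝ) : ℝ :=
  if z < Real.exp (2 * a) then Real.exp (2 * c0) * Real.exp (-a ^ 2 / 2 - (2 * d + 1) * a)
  else if z < Real.exp (a ^ 2 / (12 * d)) then Real.exp (2 * c0) * Real.exp (-(2 / 3) * a ^ 2)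
  else C3 c0 * (Real.exp (-a ^ 2) / a ^ 2)

section
variable {d : ℕ} {Ω : Type} [MeasurableSpace Ω] (S : GaussSetting d Ω)

lemma prob_bound (hd : 1 ≤ d) {c c' : ℝ} (hSR : S.ShortRangeDecay c c')
    (hLR : S.LongRangeDecay) (hA1 : S.Assumption1) {c0 : ℝ} (hc : 0 ≤ c0) :
    ∀ᶠ L : ℕ in atTop, ∀ θ ∈ Set.Icc (0:ℝ) (Real.pi / 2), ∀ x y : Fin d → ℤ, x ≠ y →
      (S.P.prod S.P).real {ω | S.aL L - c0 / S.aL L ≤ S.ξ L ω.1 x ∧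
        S.aL L - c0 / S.aL L ≤ rotX (fun x ω => S.ξ L ω x) θ y ω}
      ≤ qq d (S.aL L) c0 (znorm (x - y)) := by
  have hd0 : (0:ℝ) < d := by exact_mod_cast (by omega : 0 < d)
  have hA2 : ∀ᶠ L : ℕ in atTop, S.dL L / S.aL L < c / (4 * (2 * d + 1)) :=
    hA1.eventually_lt_const (div_pos hSR.1 (by positivity))
  filter_upwards [eventually_ge_atTop 2, (aL_tendsto S hd).eventually_ge_atTop 1,
    (aL_tendsto S hd).eventually_ge_atTop (2 * (c0 + 2)), sqrt_log_le S hd,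
    vs_long S hLR (ε := 1 / (12 * d)) (by positivity), hA2] with L hL ha ha2 hsq hlong hA2
    θ hθ x y hxy
  have G := set_GP S L hL
  have hdl := S.dL_pos L hL
  set a := S.aL L with hadef
  have ha0 : 0 < a := by linarith
  have hac : 2 * (c0 + 2) ≤ a ^ 2 := by nlinarith
  have hV0 := vs_nonneg S L (x - y)
  have hV1 := vs_short S hSR L hL (x - y) (sub_ne_zero.2 hxy)
  set V := vs S L (x - y) with hV
  have hδ : 0 < c / S.dL L := div_pos hSR.1 hdl
  obtain ⟨hu1, -⟩ := Qt_shift (b := c0) ha hc (by linarith)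
  have hu : 0 ≤ a - c0 / a := by linarith
  have hnear := pair_near G hθ x y hu
  unfold qq
  split_ifs with h1 h2
  · refine hnear.trans (near_exp ha hc (by linarith) hV0 hV1 hδ.le ?_)
    rw [div_lt_div_iff₀ ha0 (by positivity)] at hA2
    have : (2 * (d:ℝ) + 1) ≤ a * (c / S.dL L) / 4 := by
      rw [mul_div_assoc', div_div, le_div_iff₀ (by positivity)]
      linarith
    nlinarith
  · push Not at h1
    have hl := hlong (x - y) ((Real.exp_le_exp.2 hsq).trans h1)
    have hz : 0 < znorm (x - y) := (Real.exp_pos _).trans_le h1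
    have hlog : 2 * a ≤ Real.log (znorm (x - y)) := (Real.le_log_iff_exp_le hz).2 h1
    refine hnear.trans (mid_exp ha hc (by linarith) hV0 ?_)
    have : 1 / (12 * (d:ℝ)) ≤ 1 := by
      rw [div_le_one (by positivity)]
      have : (1:ℝ) ≤ d := by exact_mod_cast hd
      linarith
    rw [← hV] at hl ⊢
    nlinarith
  · push Not at h1 h2
    have hl := hlong (x - y) ((Real.exp_le_exp.2 hsq).trans h1)
    have hz : 0 < znorm (x - y) := (Real.exp_pos _).trans_le h1
    have hlog : a ^ 2 / (12 * d) ≤ Real.log (znorm (x - y)) := (Real.le_log_iff_exp_le hz).2 h2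
    have hVa : V * a ^ 2 ≤ 1 := by
      have h3 : V * (a ^ 2 / (12 * d)) ≤ 1 / (12 * d) :=
        (mul_le_mul_of_nonneg_left hlog hV0).trans hl
      rw [mul_div_assoc', div_le_div_iff_of_pos_right (by positivity)] at h3
      exact h3
    obtain ⟨hm1, -⟩ := Qt_shift (b := c0 + 2) ha (by linarith) hac
    refine (pair_far G hθ x y (m := a - (c0 + 2) / a) hu (by linarith) ?_).trans
      (far_exp ha hc hac)
    have h4 : V * a ≤ 1 / a := by rw [le_div_iff₀ ha0]; nlinarith
    have h5 : 0 ≤ c0 / a := by positivity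
    have h6 : V * (a - c0 / a) ≤ V * a := mul_le_mul_of_nonneg_left (by linarith) hV0
    have h7 : (c0 + 2) / a = c0 / a + 2 * (1 / a) := by ring
    rw [h7]
    change _ ≤ a - c0 / a - 2 * V * (a - c0 / a)
    linarith
end


lemma sum_alg (d : ℕ) (hd : 0 < (d:ℝ)) {a c0 κ e' : ℝ} (ha : 12 ≤ a) (hκ : 0 < κ) :
    let W := 2 ^ d * (a / κ * Real.exp (a ^ 2 / 2))
    W * ((3 * Real.exp (2 * a)) ^ d * (a ^ 2 * (Real.exp (2 * c0) * Real.exp (-a ^ 2 / 2 - (2 * d + 1) * a)))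
      + (3 * Real.exp (a ^ 2 / (12 * d))) ^ d * (a ^ 2 * (Real.exp (2 * c0) * Real.exp (-(2 / 3) * a ^ 2)))
      + W * (e' * (C3 c0 * (Real.exp (-a ^ 2) / a ^ 2))))
    ≤ 2 ^ d / κ * 3 ^ d * Real.exp (2 * c0) * 2 * (a ^ 3 * Real.exp (-a))
      + (2 ^ d / κ) ^ 2 * C3 c0 * e' := by
  intro W
  have ha0 : 0 < a := by linarith
  have e1 : W * ((3 * Real.exp (2 * a)) ^ d * (a ^ 2 * (Real.exp (2 * c0) * Real.exp (-a ^ 2 / 2 - (2 * d + 1) * a))))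
      = 2 ^ d / κ * 3 ^ d * Real.exp (2 * c0) * (a ^ 3 * Real.exp (-a)) := by
    have : Real.exp (a ^ 2 / 2) * Real.exp (2 * a) ^ d * Real.exp (-a ^ 2 / 2 - (2 * d + 1) * a)
        = Real.exp (-a) := by
      rw [← Real.exp_nat_mul, ← Real.exp_add, ← Real.exp_add]; congr 1; ring
    rw [← this, mul_pow]; simp only [W]; ring
  have e2 : W * ((3 * Real.exp (a ^ 2 / (12 * d))) ^ d * (a ^ 2 * (Real.exp (2 * c0) * Real.exp (-(2 / 3) * a ^ 2))))
      ≤ 2 ^ d / κ * 3 ^ d * Real.exp (2 * c0) * (a ^ 3 * Real.exp (-a)) := by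
    have : Real.exp (a ^ 2 / 2) * Real.exp (a ^ 2 / (12 * d)) ^ d * Real.exp (-(2 / 3) * a ^ 2)
        ≤ Real.exp (-a) := by
      rw [← Real.exp_nat_mul, ← Real.exp_add, ← Real.exp_add]
      apply Real.exp_le_exp.2
      have : (d:ℝ) * (a ^ 2 / (12 * d)) = a ^ 2 / 12 := by field_simp
      rw [this]; nlinarith
    calc _ = 2 ^ d / κ * 3 ^ d * Real.exp (2 * c0) * (a ^ 3 * (Real.exp (a ^ 2 / 2) *
          Real.exp (a ^ 2 / (12 * d)) ^ d * Real.exp (-(2 / 3) * a ^ 2))) := by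
            rw [mul_pow]; simp only [W]; ring
      _ ≤ _ := by gcongr
  have e3 : W * (W * (e' * (C3 c0 * (Real.exp (-a ^ 2) / a ^ 2)))) = (2 ^ d / κ) ^ 2 * C3 c0 * e' := by
    have : Real.exp (-a ^ 2) = (Real.exp (a ^ 2 / 2) * Real.exp (a ^ 2 / 2))⁻¹ := by
      rw [← Real.exp_add, ← Real.exp_neg]; congr 1; ring
    rw [this]; simp only [W]; field_simp
  rw [mul_add, mul_add, e1, e3]
  linarith

section
variable {d : ℕ} {Ω : Type} [MeasurableSpace Ω] (S : GaussSetting d Ω)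

lemma sum_bound (hd : 1 ≤ d) {c c' : ℝ} (hSR : S.ShortRangeDecay c c')
    (hLR : S.LongRangeDecay) {c0 η : ℝ} (hη : 0 < η) :
    ∀ᶠ L : ℕ in atTop, ∑ x ∈ QBox d (L:ℝ), ∑ y ∈ (QBox d (L:ℝ)).erase x,
      vs S L (x - y) * (S.aL L ^ 2 * qq d (S.aL L) c0 (znorm (x - y))) ≤ η := by
  have hd0 : (0:ℝ) < d := by exact_mod_cast (by omega : 0 < d)
  have kp := kap_pos
  have C3p := C3_pos c0
  set G : ℝ := (2 ^ d / kap) ^ 2 * C3 c0 with hG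
  have hGp : 0 < G := by positivity
  set ε : ℝ := η / 2 / G / (12 * d) with hε
  have hεp : 0 < ε := by positivity
  have hlim : Tendsto (fun L => 2 ^ d / kap * 3 ^ d * Real.exp (2 * c0) * 2 *
      (S.aL L ^ 3 * Real.exp (-S.aL L))) atTop (nhds 0) := by
    have := ((Real.tendsto_pow_mul_exp_neg_atTop_nhds_zero 3).comp (aL_tendsto S hd)).const_mul
      (2 ^ d / kap * 3 ^ d * Real.exp (2 * c0) * 2)
    simpa using! this
  filter_upwards [hlim.eventually_lt_const (half_pos hη), vs_long S hLR hεp, sqrt_log_le S hd,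
    (aL_tendsto S hd).eventually_ge_atTop 12, eventually_ge_atTop 2] with L hsm hvl hsq ha hL
  set a := S.aL L with hadef
  have ha0 : 0 < a := by linarith
  set Q := QBox d (L:ℝ)
  set W := 2 ^ d * (a / kap * Real.exp (a ^ 2 / 2)) with hW
  have hQW : (Q.card : ℝ) ≤ W :=
    (card_QBox d L (by omega)).trans
      (mul_le_mul_of_nonneg_left (N_le S L hL (by linarith)) (by positivity))
  set b1 := a ^ 2 * (Real.exp (2 * c0) * Real.exp (-a ^ 2 / 2 - (2 * d + 1) * a)) with hb1
  set b2 := a ^ 2 * (Real.exp (2 * c0) * Real.exp (-(2 / 3) * a ^ 2)) with hb2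
  set b3 := (12 * d * ε) * (C3 c0 * (Real.exp (-a ^ 2) / a ^ 2)) with hb3
  have b1p : 0 ≤ b1 := by positivity
  have b2p : 0 ≤ b2 := by positivity
  have b3p : 0 ≤ b3 := by positivity
  have hpt : ∀ w : Fin d → ℤ, w ≠ 0 → vs S L w * (a ^ 2 * qq d a c0 (znorm w)) ≤
      (if znorm w < Real.exp (2 * a) then b1 else 0)
      + (if znorm w < Real.exp (a ^ 2 / (12 * d)) then b2 else 0) + b3 := by
    intro w hw
    have hv0 := vs_nonneg S L w
    have hv1 : vs S L w ≤ 1 := by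
      have h1 := vs_short S hSR L hL w hw
      have : 0 ≤ c / S.dL L := div_nonneg hSR.1.le (S.dL_pos L hL).le
      linarith
    unfold qq
    by_cases h1 : znorm w < Real.exp (2 * a)
    · simp only [h1, if_true]
      have : vs S L w * b1 ≤ b1 := mul_le_of_le_one_left b1p hv1
      split_ifs <;> linarith
    by_cases h2 : znorm w < Real.exp (a ^ 2 / (12 * d))
    · simp only [h1, h2, if_true, if_false]
      have : vs S L w * b2 ≤ b2 := mul_le_of_le_one_left b2p hv1
      linarith
    simp only [h1, h2, if_false]
    rw [not_lt] at h1 h2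
    have h3 := hvl w ((Real.exp_le_exp.2 hsq).trans h1)
    have h4 : a ^ 2 / (12 * d) ≤ Real.log (znorm w) :=
      (Real.le_log_iff_exp_le (lt_of_lt_of_le (Real.exp_pos _) h2)).2 h2
    have h5 : vs S L w * (a ^ 2 / (12 * d)) ≤ ε := (mul_le_mul_of_nonneg_left h4 hv0).trans h3
    have h6 : vs S L w * a ^ 2 ≤ 12 * d * ε := by
      have : vs S L w * a ^ 2 = 12 * d * (vs S L w * (a ^ 2 / (12 * d))) := by field_simp
      rw [this]; gcongr
    have : vs S L w * (a ^ 2 * (C3 c0 * (Real.exp (-a ^ 2) / a ^ 2))) ≤ b3 := by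
      rw [← mul_assoc, hb3]; gcongr
    linarith
  have hrow : ∀ x ∈ Q, ∑ y ∈ Q.erase x, vs S L (x - y) * (a ^ 2 * qq d a c0 (znorm (x - y)))
      ≤ (3 * Real.exp (2 * a)) ^ d * b1 + (3 * Real.exp (a ^ 2 / (12 * d))) ^ d * b2 + W * b3 := by
    intro x hx
    calc _ ≤ ∑ y ∈ Q.erase x, ((if znorm (x - y) < Real.exp (2 * a) then b1 else 0)
      + (if znorm (x - y) < Real.exp (a ^ 2 / (12 * d)) then b2 else 0) + b3) := by
          apply Finset.sum_le_sum
          intro y hy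
          exact hpt _ (sub_ne_zero.2 (Finset.ne_of_mem_erase hy).symm)
      _ ≤ ∑ y ∈ Q, ((if znorm (x - y) < Real.exp (2 * a) then b1 else 0)
      + (if znorm (x - y) < Real.exp (a ^ 2 / (12 * d)) then b2 else 0) + b3) := by
          apply Finset.sum_le_sum_of_subset_of_nonneg (Finset.erase_subset _ _)
          intro y _ _
          split_ifs <;> positivity
      _ = ((Q.filter (fun y => znorm (x - y) < Real.exp (2 * a))).card : ℝ) * b1
          + ((Q.filter (fun y => znorm (x - y) < Real.exp (a ^ 2 / (12 * d)))).card : ℝ) * b2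
          + Q.card * b3 := by
          rw [Finset.sum_add_distrib, Finset.sum_add_distrib, ← Finset.sum_filter,
            ← Finset.sum_filter]
          simp [Finset.sum_const]
      _ ≤ _ := by
          have h1 := card_ball Q x (B := Real.exp (2 * a)) (Real.one_le_exp (by positivity))
          have h2 := card_ball Q x (B := Real.exp (a ^ 2 / (12 * d)))
            (Real.one_le_exp (by positivity))
          gcongr
  calc _ ≤ ∑ x ∈ Q, ((3 * Real.exp (2 * a)) ^ d * b1 +
        (3 * Real.exp (a ^ 2 / (12 * d))) ^ d * b2 + W * b3) := Finset.sum_le_sum hrow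
    _ = Q.card * ((3 * Real.exp (2 * a)) ^ d * b1 +
        (3 * Real.exp (a ^ 2 / (12 * d))) ^ d * b2 + W * b3) := by
        rw [Finset.sum_const, nsmul_eq_mul]
    _ ≤ W * ((3 * Real.exp (2 * a)) ^ d * b1 +
        (3 * Real.exp (a ^ 2 / (12 * d))) ^ d * b2 + W * b3) := by gcongr
    _ ≤ _ := sum_alg d hd0 ha kp
    _ ≤ η := by
        have : (2 ^ d / kap) ^ 2 * C3 c0 * (12 * d * ε) = η / 2 := by
          rw [← hG, hε]; field_simp
        rw [this]; linarith

end


lemma disj_of_card {α : Type*} [DecidableEq α] (n : ℕ) (B : ℕ → Finset α)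
    (h : ∑ j ∈ range n, (B j).card ≤ ((range n).biUnion B).card) {j k : ℕ} (hj : j < n)
    (hk : k < n) (hjk : j ≠ k) : Disjoint (B j) (B k) := by
  rw [Finset.disjoint_left]
  intro x hxj hxk
  have hsub : (range n).biUnion B ⊆ ((range n).erase k).biUnion B ∪ (B k).erase x := by
    intro y hy
    obtain ⟨i, hi, hyi⟩ := Finset.mem_biUnion.1 hy
    rw [Finset.mem_union]
    by_cases hik : i = k
    · by_cases hyx : y = x
      · left
        exact Finset.mem_biUnion.2 ⟨j, Finset.mem_erase.2 ⟨hjk, Finset.mem_range.2 hj⟩, hyx ▸ hxj⟩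
      · right
        exact Finset.mem_erase.2 ⟨hyx, hik ▸ hyi⟩
    · left
      exact Finset.mem_biUnion.2 ⟨i, Finset.mem_erase.2 ⟨hik, hi⟩, hyi⟩
  have h1 := Finset.card_le_card hsub
  have h2 := Finset.card_union_le (((range n).erase k).biUnion B) ((B k).erase x)
  have h3 : (((range n).erase k).biUnion B).card ≤ ∑ i ∈ (range n).erase k, (B i).card :=
    Finset.card_biUnion_le
  have h4 := Finset.add_sum_erase (range n) (fun i => (B i).card) (Finset.mem_range.2 hk)
  have h5 := Finset.card_erase_add_one hxk
  omega

lemma abs_prod_sub {α : Type*} [DecidableEq α] (s : Finset α) (f g : α → ℝ)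
    (hf0 : ∀ i ∈ s, 0 ≤ f i)
    (hf : ∀ i ∈ s, f i ≤ 1) (hg0 : ∀ i ∈ s, 0 ≤ g i) (hg : ∀ i ∈ s, g i ≤ 1) :
    |∏ i ∈ s, f i - ∏ i ∈ s, g i| ≤ ∑ i ∈ s, |f i - g i| := by
  induction s using Finset.induction_on with
  | empty => simp
  | insert i s hi ih =>
    rw [Finset.prod_insert hi, Finset.prod_insert hi, Finset.sum_insert hi]
    have ih' := ih (fun j hj => hf0 j (Finset.mem_insert_of_mem hj))
      (fun j hj => hf j (Finset.mem_insert_of_mem hj))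
      (fun j hj => hg0 j (Finset.mem_insert_of_mem hj))
      (fun j hj => hg j (Finset.mem_insert_of_mem hj))
    have hp : |∏ j ∈ s, f j| ≤ 1 := by
      rw [abs_of_nonneg (Finset.prod_nonneg fun j hj => hf0 j (Finset.mem_insert_of_mem hj))]
      exact Finset.prod_le_one (fun j hj => hf0 j (Finset.mem_insert_of_mem hj))
        (fun j hj => hf j (Finset.mem_insert_of_mem hj))
    have hgi : |g i| ≤ 1 := by
      rw [abs_of_nonneg (hg0 i (Finset.mem_insert_self i s))]
      exact hg i (Finset.mem_insert_self i s)
    have e : f i * ∏ j ∈ s, f j - g i * ∏ j ∈ s, g j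
        = (f i - g i) * ∏ j ∈ s, f j + g i * (∏ j ∈ s, f j - ∏ j ∈ s, g j) := by ring
    rw [e]
    refine (abs_add_le _ _).trans ?_
    rw [abs_mul, abs_mul]
    have h1 := mul_le_mul_of_nonneg_left hp (abs_nonneg (f i - g i))
    have h2 := mul_le_mul_of_nonneg_right hgi (abs_nonneg (∏ j ∈ s, f j - ∏ j ∈ s, g j))
    linarith

section
variable {Ω ι : Type*} [MeasurableSpace Ω] {P : Measure Ω}

lemma unit_int [IsProbabilityMeasure P] {f : Ω → ℝ} (hm : Measurable f) (h0 : ∀ ω, 0 ≤ f ω)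
    (h1 : ∀ ω, f ω ≤ 1) : Integrable f P ∧ 0 ≤ ∫ ω, f ω ∂P ∧ ∫ ω, f ω ∂P ≤ 1 := by
  have hi : Integrable f P := Integrable.of_bound hm.aestronglyMeasurable 1
    (ae_of_all _ fun ω => by rw [Real.norm_eq_abs, abs_of_nonneg (h0 ω)]; exact h1 ω)
  refine ⟨hi, integral_nonneg h0, ?_⟩
  calc ∫ ω, f ω ∂P ≤ ∫ _, (1:ℝ) ∂P := integral_mono hi (integrable_const _) h1
    _ = 1 := by simp

lemma trunc_int [DecidableEq ι] [IsProbabilityMeasure P] (s : Finset ι) (F G : ι → Ω → ℝ)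
    (hFm : ∀ i, Measurable (F i)) (hGm : ∀ i, Measurable (G i))
    (hF0 : ∀ i ω, 0 ≤ F i ω) (hF1 : ∀ i ω, F i ω ≤ 1)
    (hG0 : ∀ i ω, 0 ≤ G i ω) (hG1 : ∀ i ω, G i ω ≤ 1)
    (A : ι → Set Ω) (hA : ∀ i, MeasurableSet (A i)) (hFG : ∀ i ∈ s, ∀ ω ∉ A i, F i ω = G i ω)
    {p : ℝ} (hp : ∀ i, P.real (A i) ≤ p) :
    |∫ ω, ∏ i ∈ s, F i ω ∂P - ∫ ω, ∏ i ∈ s, G i ω ∂P| ≤ s.card * p := by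
  have iF := (unit_int (P := P) (Finset.measurable_fun_prod s fun i _ => hFm i)
    (fun ω => Finset.prod_nonneg fun i _ => hF0 i ω)
    (fun ω => Finset.prod_le_one (fun i _ => hF0 i ω) fun i _ => hF1 i ω)).1
  have iG := (unit_int (P := P) (Finset.measurable_fun_prod s fun i _ => hGm i)
    (fun ω => Finset.prod_nonneg fun i _ => hG0 i ω)
    (fun ω => Finset.prod_le_one (fun i _ => hG0 i ω) fun i _ => hG1 i ω)).1
  rw [← integral_sub iF iG]
  have hI : ∀ i, Integrable ((A i).indicator (fun _ => (1:ℝ))) P := fun i =>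
    (integrable_const _).indicator (hA i)
  calc _ ≤ ∫ ω, |∏ i ∈ s, F i ω - ∏ i ∈ s, G i ω| ∂P := abs_integral_le_integral_abs
    _ ≤ ∫ ω, ∑ i ∈ s, (A i).indicator (fun _ => (1:ℝ)) ω ∂P := by
        apply integral_mono (iF.sub iG).abs (integrable_finsetSum _ fun i _ => hI i)
        intro ω
        refine (abs_prod_sub s (fun i => F i ω) (fun i => G i ω) (fun i _ => hF0 i ω)
          (fun i _ => hF1 i ω) (fun i _ => hG0 i ω) (fun i _ => hG1 i ω)).trans ?_
        apply Finset.sum_le_sum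
        intro i hi
        by_cases h : ω ∈ A i
        · simp only [Set.indicator_of_mem h]
          rw [abs_le]
          constructor <;> linarith [hF0 i ω, hF1 i ω, hG0 i ω, hG1 i ω]
        · simp [Set.indicator_of_notMem h, hFG i hi ω h]
    _ = ∑ i ∈ s, P.real (A i) := by
        rw [integral_finsetSum _ fun i _ => hI i]
        apply Finset.sum_congr rfl
        intro i _
        rw [integral_indicator_const _ (hA i)]; simp
    _ ≤ s.card * p := by
        rw [← nsmul_eq_mul]
        exact Finset.sum_le_card_nsmul _ _ _ fun i _ => hp i

variable [DecidableEq ι] {X : ι → Ω → ℝ} {ρ : ι → ι → ℝ} {φ φ' : ι → ℝ → ℝ} {K : ℝ}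

lemma telescope (h : GP P X ρ) (T : TF φ φ' K) (D : ι → ι → ℝ) (hD0 : ∀ x y, 0 ≤ D x y)
    (hD : ∀ θ ∈ Set.Icc (0:ℝ) (Real.pi / 2), ∀ x y, x ≠ y →
      ∫ ω, |φ' x (X x ω.1)| * |φ' y (rotX X θ y ω)| ∂(P.prod P) ≤ D x y)
    (C : ℕ → Finset ι) (n : ℕ) (hC : ∀ j < n, ∀ k < n, j ≠ k → Disjoint (C j) (C k)) :
    |∫ ω, ∏ j ∈ range n, ∏ x ∈ C j, φ x (X x ω) ∂P
      - ∏ j ∈ range n, ∫ ω, ∏ x ∈ C j, φ x (X x ω) ∂P|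
    ≤ 2 * ∑ x ∈ (range n).biUnion C, ∑ y ∈ ((range n).biUnion C).erase x, ρ x y * D x y := by
  have := h.prob
  induction n with
  | zero => simp
  | succ m ih =>
    have ih' := ih fun j hj k hk hjk => hC j (by omega) k (by omega) hjk
    set U := (range m).biUnion C with hU
    have hdis : Disjoint U (C m) := by
      rw [hU, Finset.disjoint_biUnion_left]
      intro j hj
      have := Finset.mem_range.1 hj
      exact hC j (by omega) m (by omega) (by omega)
    have hU' : (range (m + 1)).biUnion C = U ∪ C m := by
      rw [Finset.range_add_one, Finset.biUnion_insert, Finset.union_comm]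
    have hprod : ∀ ω, ∏ j ∈ range m, ∏ x ∈ C j, φ x (X x ω) = ∏ x ∈ U, φ x (X x ω) := by
      intro ω
      rw [hU, Finset.prod_biUnion]
      intro j hj k hk hjk
      have h1 := Finset.mem_range.1 (Finset.mem_coe.1 hj)
      have h2 := Finset.mem_range.1 (Finset.mem_coe.1 hk)
      exact hC j (by omega) k (by omega) hjk
    rw [hU']
    simp only [Finset.prod_range_succ, hprod] at ih' ⊢
    set π := ∏ j ∈ range m, ∫ ω, ∏ x ∈ C j, φ x (X x ω) ∂P
    have hB := unit_int (P := P) (f := fun ω => ∏ x ∈ C m, φ x (X x ω))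
      (Finset.measurable_fun_prod _ fun x _ => (T.meas x).comp (h.meas x))
      (fun ω => T.prod_nonneg _ _) (fun ω => T.prod_le _ _)
    set EB := ∫ ω, ∏ x ∈ C m, φ x (X x ω) ∂P
    set EA := ∫ ω, ∏ x ∈ U, φ x (X x ω) ∂P
    have hc := cov_ineq h T U (C m) D fun θ hθ x hx y hy => hD θ hθ x y
      (fun e => Finset.disjoint_left.1 hdis hx (e ▸ hy))
    have hsum : ∑ x ∈ U, ∑ y ∈ U.erase x, ρ x y * D x y + ∑ x ∈ U, ∑ y ∈ C m, ρ x y * D x y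
        ≤ ∑ x ∈ U ∪ C m, ∑ y ∈ (U ∪ C m).erase x, ρ x y * D x y := by
      rw [← Finset.sum_add_distrib]
      refine le_trans (Finset.sum_le_sum (g := fun x => ∑ y ∈ (U ∪ C m).erase x, ρ x y * D x y)
        ?_) (Finset.sum_le_sum_of_subset_of_nonneg Finset.subset_union_left
          fun x _ _ => Finset.sum_nonneg fun y _ => mul_nonneg (h.nonneg x y) (hD0 x y))
      intro x hx
      rw [Finset.erase_union_distrib, Finset.erase_eq_of_notMem (Finset.disjoint_left.1 hdis hx),
        Finset.sum_union (hdis.mono_left (Finset.erase_subset _ _))]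
    have e : ∀ I : ℝ, I - π * EB = (I - EA * EB) + (EA - π) * EB := fun I => by ring
    rw [e]
    refine (abs_add_le _ _).trans ?_
    have h2 : |(EA - π) * EB| ≤ |EA - π| := by
      rw [abs_mul, abs_of_nonneg hB.2.1]
      exact mul_le_of_le_one_right (abs_nonneg _) hB.2.2
    linarith
end


lemma QBox_mono (d : ℕ) {r s : ℝ} (h : r ≤ s) : QBox d r ⊆ QBox d s := by
  unfold QBox
  apply Finset.Icc_subset_Icc
  · intro i; exact Int.ceil_le_ceil (by linarith)
  · intro i; exact Int.floor_le_floor (by linarith)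

lemma Qt_up {a M : ℝ} (ha : 1 ≤ a) (hM : 0 ≤ M) :
    Qt (a + M / a) ≤ Real.exp (-a ^ 2 / 2) * Real.exp (-M) / a := by
  have ha0 : 0 < a := by linarith
  have h0 : 0 ≤ M / a := by positivity
  refine (Qt_le_div (by linarith)).trans ?_
  rw [← Real.exp_add]
  have h1 : -(a + M / a) ^ 2 / 2 ≤ -a ^ 2 / 2 + -M := by
    have : (a + M / a) ^ 2 = a ^ 2 + 2 * M + (M / a) ^ 2 := by field_simp; ring
    rw [this]; nlinarith [sq_nonneg (M / a)]
  exact div_le_div₀ (Real.exp_pos _).le (Real.exp_le_exp.2 h1) ha0 (by linarith)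

lemma trunc_count {d : ℕ} {Ω : Type} [MeasurableSpace Ω] (S : GaussSetting d Ω) (L : ℕ)
    (hL : 2 ≤ L) (ha : 1 ≤ S.aL L) {M : ℝ} (hM : 0 ≤ M) :
    ((QBox d (L:ℝ)).card : ℝ) * Qt (S.aL L + M / S.aL L) ≤ 2 ^ d / kap * Real.exp (-M) := by
  have kp := kap_pos
  have ha0 : 0 < S.aL L := by linarith
  calc _ ≤ (2 ^ d * (S.aL L / kap * Real.exp (S.aL L ^ 2 / 2))) *
        (Real.exp (-S.aL L ^ 2 / 2) * Real.exp (-M) / S.aL L) := by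
        apply mul_le_mul _ (Qt_up ha hM) (Qt_nonneg _) (by positivity)
        exact (card_QBox d L (by omega)).trans
          (mul_le_mul_of_nonneg_left (N_le S L hL ha) (by positivity))
    _ = _ := by
        have : Real.exp (-S.aL L ^ 2 / 2) = (Real.exp (S.aL L ^ 2 / 2))⁻¹ := by
          rw [← Real.exp_neg]; congr 1; ring
        rw [this]; field_simp

/-- Proposition 3.4, decorrelation estimate, case `χ = ξ`.
For any compactly supported nonnegative `C²` function `g` on `[−1,1]^d × (−∞,∞]` and
any `λ ≥ 0`, the difference between
`E[∏_j ∏_{x₀ ∈ Q_{R_L,z_{j,L}}} exp(−λ g(z_{j,L}/L, a_L(ξ_L(x₀) − a_L)))]` and the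
product over `j` of the corresponding expectations tends to `0` as `L → ∞`: the
restrictions of the rescaled field to the well-separated mesoscopic boxes may
asymptotically be treated as independent. -/
theorem decorrelation_estimate
    {d : ℕ} (hd : 1 ≤ d) {Ω : Type} [MeasurableSpace Ω] (S : GaussSetting d Ω)
    (c c' : ℝ) (hSR : S.ShortRangeDecay c c')
    (hLR : S.LongRangeDecay)
    (hA1 : S.Assumption1)
    (rL RL : ℕ → ℝ)
    (hrL_lower : ∀ L : ℕ, 2 ≤ L → Real.log (S.aL L) ≤ Real.log (rL L))
    (hrL_upper : Tendsto (fun L => Real.log (rL L) / Real.sqrt (S.aL L)) atTop (nhds 0))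
    (hRL_lower : Tendsto (fun L => S.aL L / Real.log (RL L)) atTop (nhds 0))
    (hRL_upper :
      Tendsto (fun L => Real.log (RL L) / (S.aL L * (S.aL L / S.dL L))) atTop (nhds 0))
    -- the splitting scheme: `Q_L` is covered by `n_L` boxes of side `R_L + √R_L`
    -- centred at the `z_{j,L}`, whose mesoscopic sub-boxes of side `R_L` are
    -- pairwise at distance at least `√R_L`
    (n : ℕ → ℕ) (z : ℕ → ℕ → (Fin d → ℤ))
    (hcover : ∀ L : ℕ, 2 ≤ L →
      QBox d (L : ℝ) = (Finset.range (n L)).biUnion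
        (fun j => QBoxAt (RL L + Real.sqrt (RL L)) (z L j)))
    (hcard : ∀ L : ℕ, 2 ≤ L →
      n L * (QBox d (RL L + Real.sqrt (RL L))).card = (QBox d (L : ℝ)).card)
    (hsep : ∀ L : ℕ, 2 ≤ L → ∀ j < n L, ∀ k < n L, j ≠ k →
      ∀ x ∈ QBoxAt (RL L) (z L j), ∀ y ∈ QBoxAt (RL L) (z L k),
        Real.sqrt (RL L) ≤ znorm (x - y)) :
    ∀ g : (Fin d → ℝ) × EReal → ℝ, Continuous g → (∀ p, 0 ≤ g p) →
    (∃ c₀ > (0 : ℝ), ∀ p : (Fin d → ℝ) × EReal, p.2 ≤ ((-c₀ : ℝ) : EReal) → g p = 0) →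
    ContDiff ℝ 2 (fun p : (Fin d → ℝ) × ℝ => g (p.1, (p.2 : EReal))) →
    ∀ lam : ℝ, 0 ≤ lam →
    Tendsto
      (fun L : ℕ =>
        (∫ ω, ∏ j ∈ Finset.range (n L), ∏ x₀ ∈ QBoxAt (RL L) (z L j),
          Real.exp (-(lam * g (fun i => ((z L j i : ℝ) / (L : ℝ)),
            ((S.aL L * (S.ξ L ω x₀ - S.aL L) : ℝ) : EReal)))) ∂S.P)
        - ∏ j ∈ Finset.range (n L), ∫ ω, ∏ x₀ ∈ QBoxAt (RL L) (z L j),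
            Real.exp (-(lam * g (fun i => ((z L j i : ℝ) / (L : ℝ)),
              ((S.aL L * (S.ξ L ω x₀ - S.aL L) : ℝ) : EReal)))) ∂S.P)
      atTop (nhds 0) := by
  intro g hgcont hg0 hgc hgd lam hlam
  obtain ⟨c0, hc0, hgc⟩ := hgc
  have kp := kap_pos
  rw [Metric.tendsto_nhds]
  intro ε hε
  -- truncation level
  have hMlim : Tendsto (fun M : ℝ => 2 ^ d / kap * Real.exp (-M)) atTop (nhds 0) := by
    have := (Real.tendsto_exp_neg_atTop_nhds_zero).const_mul (2 ^ d / kap)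
    simpa using this
  obtain ⟨M, hM, hMε⟩ := ((eventually_ge_atTop (0:ℝ)).and
    (hMlim.eventually_lt_const (show (0:ℝ) < ε / 4 by positivity))).exists
  obtain ⟨ψ, ψ', K, hK0, hψ0, hψ1, hψd, hψm, hψK, hψc, hψM⟩ :=
    test_fn g hg0 hc0 hgc hgd lam hlam hM
  have hη : 0 < ε / (8 * (K ^ 2 + 1)) := by positivity
  filter_upwards [sum_bound S hd hSR hLR (c0 := c0) hη, prob_bound S hd hSR hLR hA1 hc0.le,
    (aL_tendsto S hd).eventually_ge_atTop 1, eventually_ge_atTop 2] with L hsum hprob ha hL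
  have hLr : (0:ℝ) < L := by exact_mod_cast (by omega : 0 < L)
  have hPr := S.hP
  have ha0 : 0 < S.aL L := by linarith
  have hcov := hcover L hL
  have hcar := hcard L hL
  have htc := trunc_count S L hL ha hM
  obtain ⟨a, hadef⟩ : ∃ a, a = S.aL L := ⟨_, rfl⟩
  rw [← hadef] at hsum hprob ha ha0 htc ⊢
  set Q := QBox d (L:ℝ) with hQ
  set C : ℕ → Finset (Fin d → ℤ) := fun j => QBoxAt (RL L) (z L j) with hCdef
  set B : ℕ → Finset (Fin d → ℤ) := fun j => QBoxAt (RL L + Real.sqrt (RL L)) (z L j) with hBdef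
  have hCB : ∀ j, C j ⊆ B j := fun j =>
    Finset.image_subset_image (QBox_mono d (by linarith [Real.sqrt_nonneg (RL L)]))
  have hBdis : ∀ j < n L, ∀ k < n L, j ≠ k → Disjoint (B j) (B k) := by
    intro j hj k hk hjk
    refine disj_of_card (n L) B ?_ hj hk hjk
    rw [← hcov, ← hcar]
    have : ∀ j, (B j).card = (QBox d (RL L + Real.sqrt (RL L))).card := fun j =>
      Finset.card_image_of_injective _ (add_right_injective _)
    simp [this]
  have hCdis : ∀ j < n L, ∀ k < n L, j ≠ k → Disjoint (C j) (C k) := fun j hj k hk hjk =>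
    (hBdis j hj k hk hjk).mono (hCB j) (hCB k)
  have hzbox : ∀ j < n L, ∀ x ∈ C j, (fun i => ((z L j i : ℝ) / (L : ℝ))) ∈ unitBox d := by
    intro j hj x hx
    obtain ⟨w, hw, -⟩ := Finset.mem_image.1 hx
    have hR : 0 ≤ RL L := by
      unfold QBox at hw
      rw [Finset.mem_Icc] at hw
      have h1 := hw.1 ⟨0, by omega⟩
      have h2 := hw.2 ⟨0, by omega⟩
      have h3 := Int.ceil_le.1 h1
      have h4 := Int.le_floor.1 h2
      linarith
    have h0 : z L j ∈ Q := by
      rw [hcov]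
      refine Finset.mem_biUnion.2 ⟨j, Finset.mem_range.2 hj, ?_⟩
      refine Finset.mem_image.2 ⟨0, ?_, by simp⟩
      unfold QBox
      have := Real.sqrt_nonneg (RL L)
      rw [Finset.mem_Icc]
      refine ⟨fun i => Int.ceil_le.2 ?_, fun i => Int.le_floor.2 ?_⟩ <;>
        simp only [Pi.zero_apply, Int.cast_zero] <;> linarith
    intro i _
    rw [hQ] at h0
    unfold QBox at h0
    rw [Finset.mem_Icc] at h0
    have h3 := Int.ceil_le.1 (h0.1 i)
    have h4 := Int.le_floor.1 (h0.2 i)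
    constructor
    · rw [le_div_iff₀ hLr]; linarith
    · rw [div_le_iff₀ hLr]; linarith
  obtain ⟨q, hq, hqC⟩ : ∃ q : (Fin d → ℤ) → (Fin d → ℝ), (∀ x, q x ∈ unitBox d) ∧
      ∀ j < n L, ∀ x ∈ C j, q x = fun i => ((z L j i : ℝ) / (L : ℝ)) := by
    classical
    have hex : ∀ x, ∃ v : Fin d → ℝ, v ∈ unitBox d ∧
        ∀ j < n L, x ∈ C j → v = fun i => ((z L j i : ℝ) / (L : ℝ)) := by
      intro x
      by_cases hx : ∃ j, j < n L ∧ x ∈ C j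
      · obtain ⟨j, hj, hxj⟩ := hx
        refine ⟨_, hzbox j hj x hxj, fun k hk hxk => ?_⟩
        by_cases hjk : j = k
        · rw [hjk]
        · exact absurd hxk (Finset.disjoint_left.1 (hCdis j hj k hk hjk) hxj)
      · refine ⟨0, fun i _ => by simp, fun j hj hxj => absurd ⟨j, hj, hxj⟩ hx⟩
    choose q h1 h2 using hex
    exact ⟨q, h1, fun j hj x hx => h2 x j hj hx⟩
  -- the true and the truncated factors
  set F : (Fin d → ℤ) → Ω → ℝ := fun x ω =>
    Real.exp (-(lam * g (q x, ((a * (S.ξ L ω x - a) : ℝ) : EReal)))) with hF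
  set φ : (Fin d → ℤ) → ℝ → ℝ := fun x y => ψ (q x) (a * (y - a)) with hφ
  set φ' : (Fin d → ℤ) → ℝ → ℝ := fun x y => ψ' (q x) (a * (y - a)) * a with hφ'
  have hstmt : ∀ j ∈ range (n L), ∀ ω, (∏ x₀ ∈ C j,
      Real.exp (-(lam * g (fun i => ((z L j i : ℝ) / (L : ℝ)),
            ((a * (S.ξ L ω x₀ - a) : ℝ) : EReal))))) = ∏ x ∈ C j, F x ω := by
    intro j hj ω
    apply Finset.prod_congr rfl
    intro x hx
    simp only [hF, hqC j (Finset.mem_range.1 hj) x hx]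
  have e1 : (∫ ω, ∏ j ∈ range (n L), ∏ x₀ ∈ C j,
      Real.exp (-(lam * g (fun i => ((z L j i : ℝ) / (L : ℝ)),
            ((a * (S.ξ L ω x₀ - a) : ℝ) : EReal)))) ∂S.P)
      = ∫ ω, ∏ j ∈ range (n L), ∏ x ∈ C j, F x ω ∂S.P :=
    integral_congr_ae (ae_of_all _ fun ω => Finset.prod_congr rfl fun j hj => hstmt j hj ω)
  have e2 : (∏ j ∈ range (n L), ∫ ω, ∏ x₀ ∈ C j,
      Real.exp (-(lam * g (fun i => ((z L j i : ℝ) / (L : ℝ)),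
            ((a * (S.ξ L ω x₀ - a) : ℝ) : EReal)))) ∂S.P)
      = ∏ j ∈ range (n L), ∫ ω, ∏ x ∈ C j, F x ω ∂S.P :=
    Finset.prod_congr rfl fun j hj => integral_congr_ae (ae_of_all _ fun ω => hstmt j hj ω)
  rw [Real.dist_eq, sub_zero]
  rw [e1, e2]
  have T : TF φ φ' (K * a) := by
    refine ⟨fun i y => hψ0 _ _, fun i y => hψ1 _ _, fun i y => ?_, fun i => ?_, fun i y => ?_,
      by positivity⟩
    · have h1 : HasDerivAt (fun y : ℝ => a * (y - a)) a y := by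
        simpa using ((hasDerivAt_id y).sub_const a).const_mul a
      exact (hψd (q i) (a * (y - a))).comp y h1
    · exact ((hψm (q i)).comp ((measurable_id.sub_const a).const_mul a)).mul_const a
    · simp only [hφ', abs_mul, abs_of_pos ha0]
      exact mul_le_mul_of_nonneg_right (hψK _ (hq i) _) ha0.le
  have hG := set_GP S L hL
  have hFm : ∀ x, Measurable (F x) := fun x => by
    have h1 : Measurable (fun ω => ((a * (S.ξ L ω x - a) : ℝ) : EReal)) :=
      measurable_coe_real_ereal.comp (((S.meas L x).sub_const a).const_mul a)
    have h2 : Measurable (fun e : EReal => g (q x, e)) :=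
      (hgcont.comp (Continuous.prodMk_right (q x))).measurable
    exact (((h2.comp h1).const_mul lam).neg).exp
  have hF0 : ∀ x ω, 0 ≤ F x ω := fun x ω => (Real.exp_pos _).le
  have hF1 : ∀ x ω, F x ω ≤ 1 := fun x ω => by
    apply Real.exp_le_one_iff.2
    have := mul_nonneg hlam (hg0 (q x, ((a * (S.ξ L ω x - a) : ℝ) : EReal)))
    linarith
  have hGm : ∀ x, Measurable (fun ω => φ x (S.ξ L ω x)) := fun x =>
    (T.meas x).comp (S.meas L x)
  set A : (Fin d → ℤ) → Set Ω := fun x => {ω | a + M / a ≤ S.ξ L ω x} with hAdef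
  have hAm : ∀ x, MeasurableSet (A x) := fun x => measurableSet_le measurable_const (S.meas L x)
  have hAp : ∀ x, S.P.real (A x) ≤ Qt (a + M / a) := fun x => by
    rw [Qt, ← set_law S L hL x, map_measureReal_apply (S.meas L x) measurableSet_Ici]
    exact le_rfl
  have hFG : ∀ x, ∀ ω ∉ A x, F x ω = φ x (S.ξ L ω x) := by
    intro x ω hω
    have h1 : S.ξ L ω x < a + M / a := not_le.1 hω
    have h2 : a * (S.ξ L ω x - a) ≤ M := by
      have h3 : a * (S.ξ L ω x - a) ≤ a * (M / a) :=
        mul_le_mul_of_nonneg_left (by linarith) ha0.le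
      rwa [mul_div_cancel₀ _ ha0.ne'] at h3
    exact (hψM (q x) _ h2).symm
  have htr : ∀ s : Finset (Fin d → ℤ),
      |∫ ω, ∏ x ∈ s, F x ω ∂S.P - ∫ ω, ∏ x ∈ s, φ x (S.ξ L ω x) ∂S.P|
      ≤ s.card * Qt (a + M / a) := fun s =>
    trunc_int s F (fun x ω => φ x (S.ξ L ω x)) hFm hGm hF0 hF1 (fun x ω => T.h0 _ _)
      (fun x ω => T.h1 _ _) A hAm (fun x _ => hFG x) hAp
  -- truncation errors
  have hdisS : Set.PairwiseDisjoint (↑(range (n L))) C := by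
    intro j hj k hk hjk
    exact hCdis j (Finset.mem_range.1 (Finset.mem_coe.1 hj)) k
      (Finset.mem_range.1 (Finset.mem_coe.1 hk)) hjk
  set U := (range (n L)).biUnion C with hU
  have hUQ : U ⊆ Q := by
    rw [hcov]
    exact Finset.biUnion_mono fun j _ => hCB j
  have hUc : (U.card : ℝ) * Qt (a + M / a) ≤ ε / 4 := by
    have h1 : (U.card : ℝ) ≤ Q.card := by exact_mod_cast Finset.card_le_card hUQ
    have := mul_le_mul_of_nonneg_right h1 (Qt_nonneg (a + M / a))
    linarith
  have t1 : |∫ ω, ∏ j ∈ range (n L), ∏ x ∈ C j, F x ω ∂S.P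
      - ∫ ω, ∏ j ∈ range (n L), ∏ x ∈ C j, φ x (S.ξ L ω x) ∂S.P| ≤ ε / 4 := by
    have h1 := htr U
    simp only [hU, Finset.prod_biUnion hdisS] at h1
    exact h1.trans hUc
  have t2 : |∏ j ∈ range (n L), ∫ ω, ∏ x ∈ C j, F x ω ∂S.P
      - ∏ j ∈ range (n L), ∫ ω, ∏ x ∈ C j, φ x (S.ξ L ω x) ∂S.P| ≤ ε / 4 := by
    have hu1 := fun j => unit_int (P := S.P) (f := fun ω => ∏ x ∈ C j, F x ω)
      (Finset.measurable_fun_prod _ fun x _ => hFm x)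
      (fun ω => Finset.prod_nonneg fun x _ => hF0 x ω)
      (fun ω => Finset.prod_le_one (fun x _ => hF0 x ω) fun x _ => hF1 x ω)
    have hu2 := fun j => unit_int (P := S.P) (f := fun ω => ∏ x ∈ C j, φ x (S.ξ L ω x))
      (Finset.measurable_fun_prod _ fun x _ => hGm x)
      (fun ω => T.prod_nonneg _ _) (fun ω => T.prod_le _ _)
    refine (abs_prod_sub _ _ _ (fun j _ => (hu1 j).2.1) (fun j _ => (hu1 j).2.2)
      (fun j _ => (hu2 j).2.1) (fun j _ => (hu2 j).2.2)).trans ?_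
    refine (Finset.sum_le_sum fun j _ => htr (C j)).trans ?_
    rw [← Finset.sum_mul]
    have : (U.card : ℝ) = ∑ j ∈ range (n L), ((C j).card : ℝ) := by
      rw [hU, Finset.card_biUnion hdisS]; push_cast; rfl
    rw [← this]
    exact hUc
  -- decorrelation of the truncated functional
  have hqq : ∀ w, 0 ≤ qq d a c0 w := fun w => by
    have := C3_pos c0
    unfold qq; split_ifs <;> positivity
  have hpt : ∀ x y, |φ' x y| ≤ K * a * Set.indicator (Set.Ici (a - c0 / a)) (fun _ => (1:ℝ)) y := by
    intro x y
    by_cases hy : y ∈ Set.Ici (a - c0 / a)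
    · rw [Set.indicator_of_mem hy, mul_one]; exact T.hK x y
    · rw [Set.indicator_of_notMem hy, mul_zero]
      have h1 : y < a - c0 / a := not_le.1 hy
      have h2 : a * (y - a) < -c0 := by
        have h3 : a * (y - a) < a * (-(c0 / a)) := mul_lt_mul_of_pos_left (by linarith) ha0
        have h4 : a * (-(c0 / a)) = -c0 := by field_simp
        linarith
      simp only [hφ', hψc _ _ h2, zero_mul, abs_zero, le_refl]
  have hD : ∀ θ ∈ Set.Icc (0:ℝ) (Real.pi / 2), ∀ x y, x ≠ y →
      ∫ ω, |φ' x (S.ξ L ω.1 x)| * |φ' y (rotX (fun x ω => S.ξ L ω x) θ y ω)| ∂(S.P.prod S.P)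
        ≤ K ^ 2 * (a ^ 2 * qq d a c0 (znorm (x - y))) := by
    intro θ hθ x y hxy
    set E : Set (Ω × Ω) := {ω | a - c0 / a ≤ S.ξ L ω.1 x ∧
        a - c0 / a ≤ rotX (fun x ω => S.ξ L ω x) θ y ω} with hE
    have hEm : MeasurableSet E :=
      (measurableSet_le measurable_const ((S.meas L x).comp measurable_fst)).inter
        (measurableSet_le measurable_const (rotX_meas hG θ y))
    calc _ ≤ ∫ ω, E.indicator (fun _ => (K * a) ^ 2) ω ∂(S.P.prod S.P) := by
          apply integral_mono_of_nonneg (ae_of_all _ fun ω => by positivity)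
            ((integrable_const _).indicator hEm)
          refine ae_of_all _ fun ω => ?_
          have h1 := hpt x (S.ξ L ω.1 x)
          have h2 := hpt y (rotX (fun x ω => S.ξ L ω x) θ y ω)
          refine (mul_le_mul h1 h2 (abs_nonneg _) ((abs_nonneg _).trans h1)).trans (le_of_eq ?_)
          simp only [Set.indicator_apply, Set.mem_Ici, hE, Set.mem_ofPred_eq]
          by_cases p1 : a - c0 / a ≤ S.ξ L ω.1 x <;>
            by_cases p2 : a - c0 / a ≤ rotX (fun x ω => S.ξ L ω x) θ y ω <;>
            simp [p1, p2, pow_two]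
      _ = (K * a) ^ 2 * (S.P.prod S.P).real E := by
          rw [integral_indicator_const _ hEm, smul_eq_mul, mul_comm]
      _ ≤ (K * a) ^ 2 * qq d a c0 (znorm (x - y)) :=
          mul_le_mul_of_nonneg_left (hprob θ hθ x y hxy) (sq_nonneg _)
      _ = _ := by ring
  have t3 := telescope hG T (fun x y => K ^ 2 * (a ^ 2 * qq d a c0 (znorm (x - y))))
    (fun x y => mul_nonneg (sq_nonneg _) (mul_nonneg (sq_nonneg _) (hqq _))) hD C (n L) hCdis
  have t4 : 2 * ∑ x ∈ U, ∑ y ∈ U.erase x,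
      vs S L (x - y) * (K ^ 2 * (a ^ 2 * qq d a c0 (znorm (x - y)))) ≤ ε / 4 := by
    have hnn : ∀ x y, 0 ≤ vs S L (x - y) * (a ^ 2 * qq d a c0 (znorm (x - y))) := fun x y =>
      mul_nonneg (vs_nonneg S L _) (mul_nonneg (sq_nonneg _) (hqq _))
    have h1 : ∑ x ∈ U, ∑ y ∈ U.erase x,
        vs S L (x - y) * (K ^ 2 * (a ^ 2 * qq d a c0 (znorm (x - y))))
        = K ^ 2 * ∑ x ∈ U, ∑ y ∈ U.erase x,
          vs S L (x - y) * (a ^ 2 * qq d a c0 (znorm (x - y))) := by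
      simp only [Finset.mul_sum]
      refine Finset.sum_congr rfl fun x _ => Finset.sum_congr rfl fun y _ => by ring
    have h2 : ∑ x ∈ U, ∑ y ∈ U.erase x,
          vs S L (x - y) * (a ^ 2 * qq d a c0 (znorm (x - y))) ≤ ε / (8 * (K ^ 2 + 1)) := by
      refine le_trans ?_ hsum
      refine (Finset.sum_le_sum fun x _ => Finset.sum_le_sum_of_subset_of_nonneg
        (Finset.erase_subset_erase x hUQ) fun y _ _ => hnn x y).trans ?_
      exact Finset.sum_le_sum_of_subset_of_nonneg hUQ fun x _ _ =>
        Finset.sum_nonneg fun y _ => hnn x y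
    rw [h1]
    have h3 := mul_le_mul_of_nonneg_left h2 (sq_nonneg K)
    have h4 : K ^ 2 * (ε / (8 * (K ^ 2 + 1))) ≤ ε / 8 := by
      rw [mul_div_assoc', div_le_div_iff₀ (by positivity) (by norm_num)]
      nlinarith
    linarith
  have t5 := t3.trans t4
  rw [abs_le] at t1 t2 t5
  rw [abs_lt]
  constructor <;> linarith [t1.1, t1.2, t2.1, t2.2, t5.1, t5.2]
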